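/- arXiv:1209.4094 — 4 statements merged into one kernel-verified Lean document; each statement's English description precedes it below -/
import Mathlib

section
/- Let α be a C*-partial action of a discrete group G on a C*-algebra A and (F_t)_{t∈G} a family of functions F_t : A×A → A_t. Then (F_t) is an enveloping family of functions for α if and only if: (I') each F_t is linear in both variables and F_e is the multiplication of A; (II') F_t(a,b)* = α_t(F_{t⁻¹}(b*, a*)), F_t(a,bc) = F_t(a,b)c, F_t(F_s(a,b), c) = F_{ts}(a, F_t(b,c)), and a·F_t(b,c) = α_t(F_{t⁻¹}(a,b))·c for all a,b,c ∈ A and s,t ∈ G; (III') if a ∈ A_{t⁻¹} and b ∈ A then F_{st}(a,b) = F_s(α_t(a), b) for all s ∈ G. -/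
set_option linter.unusedSectionVars false
set_option linter.unusedVariables false

universe u v w x y

section PartialActionPrelim

variable (k : Type u) [CommRing k] (G : Type v) [Group G] (A : Type w)
  [NonUnitalRing A] [Module k A] [SMulCommClass k A A] [IsScalarTower k A A]

/-- A partial action of a group `G` on a (not necessarily unital) `k`-algebra `A`:
a family of two-sided ideals `A_t` and algebra isomorphisms `α_t : A_{t⁻¹} → A_t`
(encoded by total functions `act t : A → A` whose behaviour only matters on `A_{t⁻¹}`). -/
structure AlgPartialAction : Type (max u v w) where
  ideal : G → Submodule k A
  act : G → A → A
  mul_mem_left : ∀ (t : G) (a : A), ∀ x ∈ ideal t, a * x ∈ ideal t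
  mul_mem_right : ∀ (t : G) (a : A), ∀ x ∈ ideal t, x * a ∈ ideal t
  ideal_one : ideal 1 = ⊤
  act_one : ∀ a : A, act 1 a = a
  act_mem : ∀ t : G, ∀ a ∈ ideal t⁻¹, act t a ∈ ideal t
  act_add : ∀ t : G, ∀ a ∈ ideal t⁻¹, ∀ b ∈ ideal t⁻¹, act t (a + b) = act t a + act t b
  act_smul : ∀ (t : G) (c : k), ∀ a ∈ ideal t⁻¹, act t (c • a) = c • act t a
  act_mul : ∀ t : G, ∀ a ∈ ideal t⁻¹, ∀ b ∈ ideal t⁻¹, act t (a * b) = act t a * act t b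
  act_injOn : ∀ t : G, Set.InjOn (act t) (ideal t⁻¹ : Set A)
  act_image : ∀ s t : G,
    act t '' ((ideal t⁻¹ : Set A) ∩ (ideal s : Set A)) = (ideal t : Set A) ∩ (ideal (t * s) : Set A)
  act_comp : ∀ s t : G, ∀ a ∈ ideal t⁻¹, act t a ∈ ideal s⁻¹ → act s (act t a) = act (s * t) a

/-- The annihilator `Ann(B) = {b ∈ B : bB = Bb = 0}`. -/
def annih (B : Type x) [NonUnitalRing B] : Set B := {b | ∀ c : B, b * c = 0 ∧ c * b = 0}

variable {k G A}

/-- An enveloping pair `(μ, β)` for a partial action `α` (in the purely algebraic sense). -/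
structure EnvPair (α : AlgPartialAction k G A) (B : Type x) [NonUnitalRing B]
    [Module k B] [SMulCommClass k B B] [IsScalarTower k B B] : Type (max u v w x) where
  β : G → B →ₙₐ[k] B
  β_one : ∀ b : B, β 1 b = b
  β_comp : ∀ (s t : G) (b : B), β (s * t) b = β s (β t b)
  μ : A →ₙₐ[k] B
  μ_inj : Function.Injective μ
  μ_mul_mem_left : ∀ b : B, ∀ x ∈ Set.range μ, b * x ∈ Set.range μ
  μ_mul_mem_right : ∀ b : B, ∀ x ∈ Set.range μ, x * b ∈ Set.range μ
  inter : ∀ t : G, ⇑μ '' (α.ideal t : Set A) = Set.range μ ∩ (⇑(β t) '' Set.range μ)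
  equivar : ∀ t : G, ∀ a ∈ α.ideal t⁻¹, β t (μ a) = μ (α.act t a)
  spans : Submodule.span k (⋃ t : G, ⇑(β t) '' Set.range μ) = ⊤

/-- An enveloping family of functions for a partial action `α` (Definition 1.7). -/
structure IsEnvFamily (α : AlgPartialAction k G A) (F : G → A → A → A) : Prop where
  mem : ∀ (t : G) (a b : A), F t a b ∈ α.ideal t
  add_left : ∀ (t : G) (a a' b : A), F t (a + a') b = F t a b + F t a' b
  add_right : ∀ (t : G) (a b b' : A), F t a (b + b') = F t a b + F t a b'
  smul_left : ∀ (t : G) (c : k) (a b : A), F t (c • a) b = c • F t a b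
  smul_right : ∀ (t : G) (c : k) (a b : A), F t a (c • b) = c • F t a b
  F_one : ∀ a b : A, F 1 a b = a * b
  cond2a : ∀ (t : G) (a b c : A), F t a (b * c) = F t a b * c
  cond2b : ∀ (t : G) (a b c : A), α.act t (F t⁻¹ (a * b) c) = a * α.act t (F t⁻¹ b c)
  cond2c : ∀ (t : G) (a b c : A), a * F t b c = α.act t (F t⁻¹ a b) * c
  cond3a : ∀ (s t : G) (a b c : A), F t (F s a b) c = F (t * s) a (F t b c)
  cond3b : ∀ (s t : G) (a b c : A), F t (α.act s⁻¹ (F s a b)) c = F t a (F (t * s⁻¹) b c)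
  cond4 : ∀ a : A, a = 0 ↔ ∀ (t : G) (b : A), F t a b = 0 ∧ F t b a = 0
  cond5a : ∀ (s t : G) (b : A), ∀ a ∈ α.ideal t⁻¹, F (s * t) a b = F s (α.act t a) b
  cond5b : ∀ (s t : G) (b : A), ∀ a ∈ α.ideal t⁻¹,
    α.act (s * t) (F (t⁻¹ * s⁻¹) b a) = α.act s (F s⁻¹ b (α.act t a))
  cond6 : ∀ (t : G) (a : A),
    (∃ b : A, ∀ (s : G) (c : A), F s a c = F (s * t) b c ∧ F s c a = α.act t (F (t⁻¹ * s) c b)) →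
    a ∈ α.ideal t

end PartialActionPrelim

section CStarPrelim

variable (G : Type u) [Group G] (A : Type v) [NonUnitalCStarAlgebra A]

/-- A C*-partial action of a (discrete) group `G` on a C*-algebra `A`: an algebraic partial
action whose ideals are closed and whose partial maps are *-preserving (i.e. *-isomorphisms
`A_{t⁻¹} → A_t`). -/
structure CStarPartialAction extends AlgPartialAction ℂ G A : Type (max u v) where
  ideal_closed : ∀ t : G, IsClosed (toAlgPartialAction.ideal t : Set A)
  act_star : ∀ t : G, ∀ a ∈ toAlgPartialAction.ideal t⁻¹,
    toAlgPartialAction.act t (star a) = star (toAlgPartialAction.act t a)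

variable {G A}

/-- An (increasing) approximate unit of the closed ideal `I`: an increasing net of positive
elements of norm at most `1` with `lim_i ‖u_i x - x‖ = 0` for all `x ∈ I`. -/
structure IsApproxUnit [PartialOrder A] [StarOrderedRing A] {ι : Type x} [Preorder ι]
    (I : Submodule ℂ A) (u : ι → A) : Prop where
  mem : ∀ i, u i ∈ I
  nonneg : ∀ i, 0 ≤ u i
  norm_le_one : ∀ i, ‖u i‖ ≤ 1
  mono : Monotone u
  approx : ∀ x ∈ I, Filter.Tendsto (fun i => ‖u i * x - x‖) Filter.atTop (nhds 0)

/-- Property (NS): for all `a, b ∈ A`, `t ∈ G` and every approximate unit `(u_i)` of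
`A_{t⁻¹}`, the net `(α_t(u_i a) b)` converges in `A`. -/
def HasNS [PartialOrder A] [StarOrderedRing A] (α : CStarPartialAction G A) : Prop :=
  ∀ (t : G) (a b : A) (ι : Type v) [Preorder ι] [IsDirected ι (· ≤ ·)] [Nonempty ι],
    ∀ u : ι → A, IsApproxUnit (α.ideal t⁻¹) u →
      ∃ x : A, Filter.Tendsto (fun i => α.act t (u i * a) * b) Filter.atTop (nhds x)

/-- A C*-enveloping pair `(μ, β)` for a C*-partial action `α` of a discrete group. -/
structure CStarEnvPair (α : CStarPartialAction G A) (B : Type w) [NonUnitalCStarAlgebra B] :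
    Type (max u v w) where
  β : G → B →ₙₐ[ℂ] B
  β_star : ∀ (t : G) (b : B), β t (star b) = star (β t b)
  β_one : ∀ b : B, β 1 b = b
  β_comp : ∀ (s t : G) (b : B), β (s * t) b = β s (β t b)
  μ : A →ₙₐ[ℂ] B
  μ_star : ∀ a : A, μ (star a) = star (μ a)
  μ_inj : Function.Injective μ
  range_closed : IsClosed (Set.range μ)
  μ_mul_mem_left : ∀ b : B, ∀ x ∈ Set.range μ, b * x ∈ Set.range μ
  μ_mul_mem_right : ∀ b : B, ∀ x ∈ Set.range μ, x * b ∈ Set.range μ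
  inter : ∀ t : G, ⇑μ '' (α.ideal t : Set A) = Set.range μ ∩ (⇑(β t) '' Set.range μ)
  equivar : ∀ t : G, ∀ a ∈ α.ideal t⁻¹, β t (μ a) = μ (α.act t a)
  dense_span : Dense
    ((Submodule.span ℂ (⋃ t : G, ⇑(β t) '' Set.range μ) : Submodule ℂ B) : Set B)

end CStarPrelim

/-- Every element `x` of a C⋆-algebra is a limit of products `x * e` with `e` in the C⋆-subalgebra
generated by `star x * x`. -/
theorem mem_of_isClosed_of_forall_mul_elemental_mem {A : Type*} [NonUnitalCStarAlgebra A]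
    {S : Set A} (hS : IsClosed S) (x : A)
    (h : ∀ e ∈ NonUnitalStarAlgebra.elemental ℂ (star x * x), x * e ∈ S) : x ∈ S := by
  let B := NonUnitalStarAlgebra.elemental ℂ (star x * x)
  let _ : PartialOrder B := CStarAlgebra.spectralOrder B
  have : StarOrderedRing B := CStarAlgebra.spectralOrderedRing B
  let l : Filter B := CStarAlgebra.approximateUnit B
  have hl : l.IsIncreasingApproximateUnit := CStarAlgebra.increasingApproximateUnit B
  have : l.NeBot := hl.neBot
  let y : B := ⟨star x * x, NonUnitalStarAlgebra.elemental.self_mem ℂ _⟩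
  have hy : Filter.Tendsto (fun e : B => 2 * ‖y * e - y‖) l (nhds 0) := by
    simpa using (tendsto_iff_norm_sub_tendsto_zero.1 (hl.tendsto_mul_left y)).const_mul 2
  have hsq : Filter.Tendsto (fun e : B => ‖x * (e : A) - x‖ ^ 2) l (nhds 0) := by
    refine squeeze_zero' (.of_forall fun e => by positivity) ?_ hy
    filter_upwards [hl.eventually_norm] with e he
    have he' : ‖(e : A)‖ ≤ 1 := he
    have key : star (x * (e : A) - x) * (x * (e : A) - x) =
        star (e : A) * ((y * e - y : B) : A) - ((y * e - y : B) : A) := by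
      change _ = star (e : A) * (star x * x * e - star x * x) - (star x * x * e - star x * x)
      simp only [star_sub, star_mul, mul_sub, sub_mul, mul_assoc]
      abel
    calc ‖x * (e : A) - x‖ ^ 2 = ‖star (x * (e : A) - x) * (x * (e : A) - x)‖ := by
          rw [CStarRing.norm_star_mul_self, sq]
      _ ≤ ‖star (e : A)‖ * ‖((y * e - y : B) : A)‖ + ‖((y * e - y : B) : A)‖ := by
          rw [key]
          exact (norm_sub_le _ _).trans (by gcongr; exact norm_mul_le _ _)
      _ ≤ 1 * ‖((y * e - y : B) : A)‖ + ‖((y * e - y : B) : A)‖ := by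
          rw [norm_star]; gcongr
      _ = 2 * ‖y * e - y‖ := by
          rw [one_mul, two_mul]; rfl
  have hlim : Filter.Tendsto (fun e : B => x * (e : A)) l (nhds x) := by
    rw [tendsto_iff_norm_sub_tendsto_zero]
    simpa using hsq.sqrt
  exact hS.mem_of_tendsto hlim (.of_forall fun e => h e e.2)

namespace CStarPartialAction

variable {G : Type*} [Group G] {A : Type*} [NonUnitalCStarAlgebra A]
  (α : CStarPartialAction G A)

theorem mem_ideal_of_forall_mul_mem {t : G} {a : A} (h : ∀ c, a * c ∈ α.ideal t) :
    a ∈ α.ideal t :=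
  mem_of_isClosed_of_forall_mul_elemental_mem (α.ideal_closed t) a fun c _ => h c

/-- Closed two-sided ideals of a C⋆-algebra are self-adjoint. -/
theorem star_mem_ideal {t : G} {x : A} (hx : x ∈ α.ideal t) : star x ∈ α.ideal t := by
  let S : NonUnitalStarSubalgebra ℂ A :=
    { carrier := {z | z ∈ α.ideal t ∧ star z ∈ α.ideal t}
      add_mem' := fun ha hb => ⟨add_mem ha.1 hb.1, by rw [star_add]; exact add_mem ha.2 hb.2⟩
      zero_mem' := ⟨zero_mem _, by rw [star_zero]; exact zero_mem _⟩
      mul_mem' := fun {a b} ha hb => ⟨α.mul_mem_left t a b hb.1, by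
        rw [star_mul]; exact α.mul_mem_left t _ _ ha.2⟩
      smul_mem' := fun c a ha => ⟨Submodule.smul_mem _ c ha.1, by
        rw [star_smul]; exact Submodule.smul_mem _ _ ha.2⟩
      star_mem' := fun {a} ha => ⟨ha.2, by rw [star_star]; exact ha.1⟩ }
  have hS : IsClosed (S : Set A) :=
    (α.ideal_closed t).inter ((α.ideal_closed t).preimage continuous_star)
  have hxS : star (star x) * star x ∈ S := by
    have h : x * star x ∈ α.ideal t := α.mul_mem_right t _ x hx
    exact ⟨by rwa [star_star], by rwa [star_mul, star_star]⟩
  refine mem_of_isClosed_of_forall_mul_elemental_mem (α.ideal_closed t) (star x) fun e he => ?_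
  exact α.mul_mem_left t _ e (NonUnitalStarAlgebra.elemental.le_of_mem hS hxS he).1

/-- Elements of `A_t` are separated by right multiplication by elements of `A_t`. -/
theorem eq_of_forall_mul_eq {t : G} {x y : A} (hx : x ∈ α.ideal t) (hy : y ∈ α.ideal t)
    (h : ∀ u ∈ α.ideal t, x * u = y * u) : x = y := by
  rw [← sub_eq_zero, ← CStarRing.mul_star_self_eq_zero_iff, sub_mul, sub_eq_zero]
  exact h _ (α.star_mem_ideal (sub_mem hx hy))

theorem act_inv_act {t : G} {a : A} (ha : a ∈ α.ideal t⁻¹) : α.act t⁻¹ (α.act t a) = a := by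
  have h := α.act_comp t⁻¹ t a ha (by rw [inv_inv]; exact α.act_mem t a ha)
  rw [h, inv_mul_cancel, α.act_one]

theorem act_act_inv {t : G} {a : A} (ha : a ∈ α.ideal t) : α.act t (α.act t⁻¹ a) = a := by
  simpa using α.act_inv_act (t := t⁻¹) (a := a) (by rwa [inv_inv])

end CStarPartialAction

namespace IsEnvFamily

variable {G : Type*} [Group G] {A : Type*} [NonUnitalCStarAlgebra A]
  {α : CStarPartialAction G A} {F : G → A → A → A}

theorem apply_of_mem_left (hF : IsEnvFamily α.toAlgPartialAction F) {t : G} {u : A}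
    (hu : u ∈ α.ideal t⁻¹) (a : A) : F t u a = α.act t u * a := by
  simpa [hF.F_one] using hF.cond5a 1 t a u hu

theorem apply_of_mem_right (hF : IsEnvFamily α.toAlgPartialAction F) {t : G} {u : A}
    (hu : u ∈ α.ideal t) (a : A) : F t a u = α.act t (a * α.act t⁻¹ u) := by
  have hv : α.act t⁻¹ u ∈ α.ideal t⁻¹ := α.act_mem t⁻¹ u (by rwa [inv_inv])
  have h := hF.cond5b t⁻¹ t a _ hv
  rw [inv_mul_cancel, inv_inv, inv_mul_cancel, α.act_one, hF.F_one, α.act_act_inv hu] at h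
  rw [h, α.act_act_inv (hF.mem t a u)]

theorem star_apply (hF : IsEnvFamily α.toAlgPartialAction F) (t : G) (a b : A) :
    star (F t a b) = α.act t (F t⁻¹ (star b) (star a)) := by
  refine α.eq_of_forall_mul_eq (α.star_mem_ideal (hF.mem t a b))
    (α.act_mem t _ (hF.mem t⁻¹ _ _)) fun u hu => ?_
  have hu' : star u ∈ α.ideal t⁻¹⁻¹ := by rw [inv_inv]; exact α.star_mem_ideal hu
  have hv : α.act t⁻¹ (star u) * a ∈ α.ideal t⁻¹ :=
    α.mul_mem_right _ _ _ (α.act_mem t⁻¹ _ hu')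
  calc star (F t a b) * u = star (star u * F t a b) := by rw [star_mul, star_star]
    _ = star (α.act t (α.act t⁻¹ (star u) * a) * b) := by
        rw [hF.cond2c, hF.apply_of_mem_left hu']
    _ = star b * α.act t (star a * α.act t⁻¹ u) := by
        rw [star_mul, ← α.act_star t _ hv, star_mul, ← α.act_star t⁻¹ _ hu', star_star]
    _ = α.act t (F t⁻¹ (star b) (star a)) * u := by
        rw [← hF.apply_of_mem_right hu, hF.cond2c]

end IsEnvFamily

/-- **Lemma 2.4.** For a C*-partial action `α` of a discrete group and a family
of functions `F_t : A × A → A_t`, the family is an enveloping family of functions iff it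
satisfies (I'), (II') and (III'). -/
theorem isEnvFamily_iff_cstar_conditions
    {G : Type u} [Group G] {A : Type v} [NonUnitalCStarAlgebra A]
    (α : CStarPartialAction G A) (F : G → A → A → A)
    (hmem : ∀ (t : G) (a b : A), F t a b ∈ α.ideal t) :
    IsEnvFamily α.toAlgPartialAction F ↔
      -- (I') each Fₜ is linear in both variables and F_e is the multiplication of A
      ((∀ (t : G) (a a' b : A), F t (a + a') b = F t a b + F t a' b) ∧
       (∀ (t : G) (a b b' : A), F t a (b + b') = F t a b + F t a b') ∧
       (∀ (t : G) (c : ℂ) (a b : A), F t (c • a) b = c • F t a b) ∧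
       (∀ (t : G) (c : ℂ) (a b : A), F t a (c • b) = c • F t a b) ∧
       (∀ a b : A, F 1 a b = a * b)) ∧
      -- (II')
      ((∀ (t : G) (a b : A), star (F t a b) = α.act t (F t⁻¹ (star b) (star a))) ∧
       (∀ (t : G) (a b c : A), F t a (b * c) = F t a b * c) ∧
       (∀ (s t : G) (a b c : A), F t (F s a b) c = F (t * s) a (F t b c)) ∧
       (∀ (t : G) (a b c : A), a * F t b c = α.act t (F t⁻¹ a b) * c)) ∧
      -- (III')
      (∀ (s t : G) (b : A), ∀ a ∈ α.ideal t⁻¹, F (s * t) a b = F s (α.act t a) b) := by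
  constructor
  · intro hF
    exact ⟨⟨hF.add_left, hF.add_right, hF.smul_left, hF.smul_right, hF.F_one⟩,
      ⟨hF.star_apply, hF.cond2a, hF.cond3a, hF.cond2c⟩, hF.cond5a⟩
  · rintro ⟨⟨add_left, add_right, smul_left, smul_right, F_one⟩,
      ⟨star_apply, mul_right, F_F, mul_left⟩, F_act⟩
    have act_F : ∀ (t : G) (a b : A), α.act t (F t⁻¹ a b) = star (F t (star b) (star a)) := by
      intro t a b
      rw [star_apply, star_star, star_star]
    exact
      { mem := hmem
        add_left := add_left
        add_right := add_right
        smul_left := smul_left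
        smul_right := smul_right
        F_one := F_one
        cond2a := mul_right
        cond2b := fun t a b c => by
          rw [act_F, act_F, star_mul, mul_right, star_mul, star_star]
        cond2c := mul_left
        cond3a := F_F
        cond3b := fun s t a b c => by
          rw [← F_act t s⁻¹ c _ (by rw [inv_inv]; exact hmem s a b), F_F, inv_mul_cancel_right]
        cond4 := fun a => by
          constructor
          · rintro rfl t b
            exact ⟨by simpa using smul_left t 0 0 b, by simpa using smul_right t 0 b 0⟩
          · intro h
            rw [← CStarRing.mul_star_self_eq_zero_iff, ← F_one]
            exact (h 1 (star a)).1
        cond5a := F_act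
        cond5b := fun s t b a ha => by
          rw [← mul_inv_rev, act_F, act_F, F_act s t _ _ (α.star_mem_ideal ha), α.act_star t a ha]
        cond6 := by
          rintro t a ⟨b, h⟩
          refine α.mem_ideal_of_forall_mul_mem fun c => ?_
          rw [← F_one, (h 1 c).1, one_mul]
          exact hmem t b c }
end

section
/- Let α be a C*-partial action of a discrete group G on a C*-algebra A. The following are equivalent: (1) α has a C*-enveloping pair; (2) α has an enveloping pair with trivial annihilator; (3) α has a (unique) enveloping family of functions; (4) α has an enveloping pair; (5) α has property (NS). -/
set_option linter.unusedSectionVars false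
set_option linter.unusedVariables false

universe u v w x y

/-- Packaged algebraic enveloping pair of a C*-partial action: a complex algebra together with
an enveloping pair (in the algebraic sense) of `α` on it. -/
structure AlgEnvelopingOf {G : Type u} [Group G] {A : Type v} [NonUnitalCStarAlgebra A]
    (α : CStarPartialAction G A) : Type (max u v + 1) where
  carrier : Type (max u v)
  [ringI : NonUnitalRing carrier]
  [modI : Module ℂ carrier]
  [sccI : SMulCommClass ℂ carrier carrier]
  [istI : IsScalarTower ℂ carrier carrier]
  pair : EnvPair α.toAlgPartialAction carrier

/-- Packaged C*-enveloping pair: a C*-algebra together with a C*-enveloping pair of `α` on it. -/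
structure CStarEnvelopingOf {G : Type u} [Group G] {A : Type v} [NonUnitalCStarAlgebra A]
    (α : CStarPartialAction G A) : Type (max u v + 1) where
  carrier : Type (max u v)
  [cstarI : NonUnitalCStarAlgebra carrier]
  pair : CStarEnvPair α carrier


section ClosedIdeal

variable {A : Type v} [NonUnitalCStarAlgebra A]

/-- Every element `y` of a C⋆-algebra is a norm limit of elements `y * e`, where `e` is a
self-adjoint element of the (algebraic) ideal generated by `star y * y`. -/
lemma exists_isSelfAdjoint_norm_sub_mul_le (y : A) (n : ℕ) :
    ∃ e : A, IsSelfAdjoint e ∧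
      e = ((n : ℝ) + 1) • (star y * y) - ((n : ℝ) + 1) • (star y * y * e) ∧
      ‖y - y * e‖ ^ 2 ≤ 1 / ((n : ℝ) + 1) := by
  let _ := CStarAlgebra.spectralOrder A
  have := CStarAlgebra.spectralOrderedRing A
  set a : A := star y * y with ha_def
  have ha : 0 ≤ a := star_mul_self_nonneg y
  have hsa : IsSelfAdjoint a := ha.isSelfAdjoint
  have hσ : ∀ r ∈ quasispectrum ℝ a, 0 ≤ r := quasispectrum_nonneg_of_nonneg a ha
  set c : ℝ := (n : ℝ) + 1 with hc_def
  have hc : 0 < c := by positivity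
  have hne : ∀ r ∈ quasispectrum ℝ a, 1 + c * r ≠ 0 := fun r hr => by
    have := hσ r hr
    positivity
  let f : ℝ → ℝ := fun r => c * r / (1 + c * r)
  have hf : ContinuousOn f (quasispectrum ℝ a) := by
    refine ContinuousOn.div (by fun_prop) (by fun_prop) hne
  have hf0 : f 0 = 0 := by simp [f]
  set e := cfcₙ f a with he_def
  have he : IsSelfAdjoint e := cfcₙ_predicate f a
  have hae : a * e = cfcₙ (fun r => r * f r) a := by
    rw [cfcₙ_mul (fun r => r) f a (by fun_prop) rfl hf hf0, cfcₙ_id' ℝ a]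
  have hea : e * a = cfcₙ (fun r => r * f r) a := by
    rw [← hae]
    simpa [hsa.star_eq, he.star_eq] using congrArg star (hae.trans
      (cfcₙ_predicate (fun r => r * f r) a : IsSelfAdjoint _).star_eq.symm) |>.trans
        (by rw [star_star, ← hae])
  have heae : e * a * e = cfcₙ (fun r => r * f r * f r) a := by
    rw [hea, cfcₙ_mul (fun r => r * f r) f a (by fun_prop) (by simp) hf hf0]
  refine ⟨e, he, ?_, ?_⟩
  · rw [hae]
    conv_rhs => enter [1, 2]; rw [← cfcₙ_id' ℝ a]
    rw [← cfcₙ_smul c (fun r => r) a (by fun_prop) rfl,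
      ← cfcₙ_smul c (fun r => r * f r) a (by fun_prop) (by simp),
      ← cfcₙ_sub _ _ a (by fun_prop) (by simp) (by fun_prop) (by simp)]
    refine cfcₙ_congr fun r hr => ?_
    have := hne r hr
    simp only [f, smul_eq_mul]
    field_simp
    ring
  · have key : star (y - y * e) * (y - y * e)
        = cfcₙ (fun r => r - r * f r - (r * f r - r * f r * f r)) a := by
      rw [cfcₙ_sub _ _ a (by fun_prop) (by simp) (by fun_prop) (by simp),
        cfcₙ_sub _ _ a (by fun_prop) (by simp) (by fun_prop) (by simp),
        cfcₙ_sub _ _ a (by fun_prop) (by simp) (by fun_prop) (by simp), cfcₙ_id' ℝ a, ← heae]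
      nth_rewrite 1 [← hae]
      rw [← hea, star_sub, star_mul, he.star_eq, ha_def]
      noncomm_ring
    rw [sq, ← CStarRing.norm_star_mul_self, key]
    refine norm_cfcₙ_le fun r hr => ?_
    have h0 := hσ r hr
    have h1 : r - r * f r - (r * f r - r * f r * f r) = r / (1 + c * r) ^ 2 := by
      have := hne r hr
      simp only [f]
      field_simp
      ring
    rw [h1, Real.norm_of_nonneg (by positivity), div_le_div_iff₀ (by positivity) hc]
    nlinarith [mul_nonneg hc.le h0, sq_nonneg (c * r)]

/-- Every element `y` of a C⋆-algebra is the limit of a sequence `y * e n`, where each `e n` is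
self-adjoint and lies in every ideal containing `star y * y`. -/
lemma exists_seq_tendsto_mul (y : A) :
    ∃ e : ℕ → A, (∀ n, IsSelfAdjoint (e n)) ∧
      (∀ I : Submodule ℂ A, (∀ x ∈ I, ∀ a, x * a ∈ I) → star y * y ∈ I → ∀ n, e n ∈ I) ∧
      Filter.Tendsto (fun n => y * e n) Filter.atTop (nhds y) := by
  choose e he heq hle using exists_isSelfAdjoint_norm_sub_mul_le y
  refine ⟨e, he, fun I hI hy n => ?_, ?_⟩
  · rw [heq n]
    exact I.sub_mem ((I.restrictScalars ℝ).smul_mem _ hy)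
      ((I.restrictScalars ℝ).smul_mem _ (hI _ hy _))
  · rw [tendsto_iff_norm_sub_tendsto_zero]
    have h : Filter.Tendsto (fun n : ℕ => Real.sqrt (1 / ((n : ℝ) + 1))) Filter.atTop (nhds 0) := by
      simpa only [Function.comp_def, Real.sqrt_zero] using
        (Real.continuous_sqrt.tendsto 0).comp (tendsto_one_div_add_atTop_nhds_zero_nat (𝕜 := ℝ))
    refine squeeze_zero (fun _ => norm_nonneg _) (fun n => ?_) h
    rw [norm_sub_rev]
    exact Real.le_sqrt_of_sq_le (hle n)

/-- A closed ideal of a C⋆-algebra is closed under the involution. -/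
lemma star_mem_of_isClosed {I : Submodule ℂ A} (hI : IsClosed (I : Set A))
    (hl : ∀ a, ∀ x ∈ I, a * x ∈ I) (hr : ∀ a, ∀ x ∈ I, x * a ∈ I) {y : A} (hy : y ∈ I) :
    star y ∈ I := by
  obtain ⟨e, he, hmem, hlim⟩ := exists_seq_tendsto_mul y
  have h := (continuous_star.tendsto y).comp hlim
  refine hI.mem_of_tendsto h (Filter.Eventually.of_forall fun n => ?_)
  simp only [Function.comp_apply, star_mul, (he n).star_eq]
  exact hr _ _ (hmem I (fun x hx a => hr a x hx) (hl _ _ hy) n)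

/-- A closed ideal of a C⋆-algebra containing `star y * y` contains `y`. -/
lemma mem_of_star_mul_self_mem {I : Submodule ℂ A} (hI : IsClosed (I : Set A))
    (hl : ∀ a, ∀ x ∈ I, a * x ∈ I) (hr : ∀ a, ∀ x ∈ I, x * a ∈ I) {y : A}
    (hy : star y * y ∈ I) : y ∈ I := by
  obtain ⟨e, -, hmem, hlim⟩ := exists_seq_tendsto_mul y
  exact hI.mem_of_tendsto hlim (Filter.Eventually.of_forall fun n =>
    hl _ _ (hmem I (fun x hx a => hr a x hx) hy n))

/-- A closed ideal of a C⋆-algebra as a star subalgebra. -/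
def closedIdealStarSubalgebra (I : Submodule ℂ A) (hI : IsClosed (I : Set A))
    (hl : ∀ a, ∀ x ∈ I, a * x ∈ I) (hr : ∀ a, ∀ x ∈ I, x * a ∈ I) :
    NonUnitalStarSubalgebra ℂ A :=
  { I with
    mul_mem' := fun {a _} _ hb => hl a _ hb
    star_mem' := fun ha => star_mem_of_isClosed hI hl hr ha }

/-- Every C⋆-algebra has an increasing approximate unit indexed by a type in its own universe.
Positivity is expressed through squares, so that no order on the algebra is involved. -/
lemma exists_increasing_approxUnit (B : Type v) [NonUnitalCStarAlgebra B] :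
    ∃ (ι : Type v) (_ : Preorder ι) (_ : IsDirected ι (· ≤ ·)) (_ : Nonempty ι) (u : ι → B),
      (∀ i, ∃ z, u i = star z * z) ∧ (∀ i, ‖u i‖ ≤ 1) ∧
      (∀ i j, i ≤ j → ∃ z, u j - u i = star z * z) ∧
      ∀ x, Filter.Tendsto (fun i => u i * x) Filter.atTop (nhds x) := by
  let _ := CStarAlgebra.spectralOrder B
  have := CStarAlgebra.spectralOrderedRing B
  have hdir : IsDirected {x : B // 0 ≤ x ∧ ‖x‖ < 1} (· ≤ ·) := ⟨fun p q => by
    obtain ⟨z, hz, hpz, hqz⟩ := CStarAlgebra.directedOn_nonneg_ball (A := B) p (by simpa using p.2)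
      q (by simpa using q.2)
    exact ⟨⟨z, by simpa using hz⟩, hpz, hqz⟩⟩
  have hne : Nonempty {x : B // 0 ≤ x ∧ ‖x‖ < 1} := ⟨⟨0, by simp⟩⟩
  refine ⟨{x : B // 0 ≤ x ∧ ‖x‖ < 1}, inferInstance, hdir, hne, Subtype.val,
    fun p => CStarAlgebra.nonneg_iff_eq_star_mul_self.mp p.2.1, fun p => p.2.2.le,
    fun p q hpq => CStarAlgebra.nonneg_iff_eq_star_mul_self.mp (sub_nonneg.mpr hpq), fun x => ?_⟩
  have hlim : Filter.Tendsto (Subtype.val : {x : B // 0 ≤ x ∧ ‖x‖ < 1} → B)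
      Filter.atTop (CStarAlgebra.approximateUnit B) := by
    rw [(CStarAlgebra.hasBasis_approximateUnit B).tendsto_right_iff]
    intro z hz
    filter_upwards [Filter.eventually_ge_atTop (⟨z, hz⟩ : {x : B // 0 ≤ x ∧ ‖x‖ < 1})] with p hp
    exact ⟨hp, by simpa using p.2.2.le⟩
  exact ((CStarAlgebra.increasingApproximateUnit B).tendsto_mul_right x).comp hlim

/-- Every closed ideal of a C⋆-algebra has an increasing approximate unit, indexed by a type in
the universe of the algebra. -/
lemma exists_isApproxUnit [PartialOrder A] [StarOrderedRing A] (I : Submodule ℂ A)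
    (hI : IsClosed (I : Set A))
    (hl : ∀ a, ∀ x ∈ I, a * x ∈ I) (hr : ∀ a, ∀ x ∈ I, x * a ∈ I) :
    ∃ (ι : Type v) (_ : Preorder ι) (_ : IsDirected ι (· ≤ ·)) (_ : Nonempty ι) (u : ι → A),
      IsApproxUnit I u := by
  let S := closedIdealStarSubalgebra I hI hl hr
  have : IsClosed (S : Set A) := hI
  obtain ⟨ι, i₁, i₂, i₃, u, hpos, hnorm, hmono, hlim⟩ := exists_increasing_approxUnit S
  refine ⟨ι, i₁, i₂, i₃, fun i => u i, fun i => (u i).2, fun i => ?_, hnorm, fun i j hij => ?_,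
    fun x hx => ?_⟩
  · obtain ⟨z, hz⟩ := hpos i
    simp [hz]
  · obtain ⟨z, hz⟩ := hmono i j hij
    have h : (u j : A) - u i = star (z : A) * z := congrArg Subtype.val hz
    exact sub_nonneg.mp (h ▸ star_mul_self_nonneg (z : A))
  · have h := tendsto_iff_norm_sub_tendsto_zero.mp (hlim ⟨x, hx⟩)
    exact h

end ClosedIdeal

namespace CStarPartialAction

variable {G : Type u} [Group G] {A : Type v} [NonUnitalCStarAlgebra A]
  (α : CStarPartialAction G A)

lemma star_mem {t : G} {y : A} (hy : y ∈ α.ideal t) : star y ∈ α.ideal t :=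
  star_mem_of_isClosed (α.ideal_closed t) (α.mul_mem_left t) (α.mul_mem_right t) hy

lemma mem_of_star_mul_self {t : G} {y : A} (hy : star y * y ∈ α.ideal t) : y ∈ α.ideal t :=
  mem_of_star_mul_self_mem (α.ideal_closed t) (α.mul_mem_left t) (α.mul_mem_right t) hy

lemma mem_ideal_one (a : A) : a ∈ α.ideal 1 := by simp [α.ideal_one]

lemma act_mem_mul {t s : G} {x : A} (hx : x ∈ α.ideal t⁻¹) (hs : x ∈ α.ideal s) :
    α.act t x ∈ α.ideal (t * s) :=
  ((α.act_image s t).subset ⟨x, ⟨hx, hs⟩, rfl⟩).2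

lemma exists_act_eq_of_mem_mul {t s : G} {p : A} (hp : p ∈ α.ideal t)
    (hs : p ∈ α.ideal (t * s)) : ∃ x ∈ α.ideal t⁻¹, x ∈ α.ideal s ∧ α.act t x = p := by
  obtain ⟨x, ⟨hx, hxs⟩, rfl⟩ := (α.act_image s t).superset ⟨hp, hs⟩
  exact ⟨x, hx, hxs, rfl⟩

lemma exists_act_eq {t : G} {p : A} (hp : p ∈ α.ideal t) :
    ∃ x ∈ α.ideal t⁻¹, α.act t x = p := by
  obtain ⟨x, hx, -, h⟩ := α.exists_act_eq_of_mem_mul (s := 1) hp (by simpa using hp)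
  exact ⟨x, hx, h⟩

lemma act_sub {t : G} {x y : A} (hx : x ∈ α.ideal t⁻¹) (hy : y ∈ α.ideal t⁻¹) :
    α.act t (x - y) = α.act t x - α.act t y := by
  rw [eq_sub_iff_add_eq, ← α.act_add t _ (sub_mem hx hy) _ hy, sub_add_cancel]

/-- The ideal `A_t` as a star subalgebra of `A`. -/
def idealStarSubalgebra (t : G) : NonUnitalStarSubalgebra ℂ A :=
  closedIdealStarSubalgebra (α.ideal t) (α.ideal_closed t) (α.mul_mem_left t) (α.mul_mem_right t)

/-- The map `α_t : A_{t⁻¹} → A` as a star homomorphism. -/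
def actHom (t : G) : α.idealStarSubalgebra t⁻¹ →⋆ₙₐ[ℂ] A where
  toFun x := α.act t x
  map_smul' c x := α.act_smul t c x x.2
  map_zero' := by simpa using α.act_smul t (0 : ℂ) 0 (zero_mem _)
  map_add' x y := α.act_add t x x.2 y y.2
  map_mul' x y := α.act_mul t x x.2 y y.2
  map_star' x := α.act_star t x x.2

lemma norm_act {t : G} {x : A} (hx : x ∈ α.ideal t⁻¹) : ‖α.act t x‖ = ‖x‖ := by
  have : IsClosed (α.idealStarSubalgebra t⁻¹ : Set A) := α.ideal_closed t⁻¹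
  have hinj : Function.Injective (α.actHom t) :=
    fun x y h => Subtype.ext (α.act_injOn t x.2 y.2 h)
  exact NonUnitalStarAlgHom.norm_map (α.actHom t) hinj (⟨x, hx⟩ : α.idealStarSubalgebra t⁻¹)

/-- Elements of `A_t ∩ A_{ts}` are determined by their left products with `A_t ∩ A_{ts}`. -/
lemma eq_of_forall_act_mul_eq {t s : G} {y z : A} (hy : y ∈ α.ideal t) (hys : y ∈ α.ideal (t * s))
    (hz : z ∈ α.ideal t) (hzs : z ∈ α.ideal (t * s))
    (h : ∀ x ∈ α.ideal t⁻¹, x ∈ α.ideal s → α.act t x * y = α.act t x * z) : y = z := by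
  obtain ⟨x, hx, hxs, hxy⟩ := α.exists_act_eq_of_mem_mul (α.star_mem (sub_mem hy hz))
    (α.star_mem (sub_mem hys hzs))
  have := h x hx hxs
  rw [hxy, ← sub_eq_zero, ← mul_sub, CStarRing.star_mul_self_eq_zero_iff] at this
  exact sub_eq_zero.mp this

/-- `y` plays the role of the product `β_t(a) b` in an enveloping algebra: it is the element of
`A_t` on which `A_t` acts as it would on this product. -/
def IsTwistedMul (t : G) (a b y : A) : Prop :=
  y ∈ α.ideal t ∧ ∀ x ∈ α.ideal t⁻¹, α.act t x * y = α.act t (x * a) * b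

/-- All the products `β_t(a) b` of a hypothetical enveloping action exist in `A`. -/
def HasTwistedMul : Prop := ∀ t a b, ∃ y, α.IsTwistedMul t a b y

variable {α}

lemma IsTwistedMul.unique {t : G} {a b y z : A} (hy : α.IsTwistedMul t a b y)
    (hz : α.IsTwistedMul t a b z) : y = z :=
  α.eq_of_forall_act_mul_eq (s := 1) hy.1 (by simpa using hy.1) hz.1 (by simpa using hz.1)
    fun x hx _ => (hy.2 x hx).trans (hz.2 x hx).symm

/-- If `y = β_t(a) b` and `J` is an ideal `A_s` containing `α_t(A_{t⁻¹} a) b`, then `y ∈ J`. -/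
lemma IsTwistedMul.mem_of_forall {t s : G} {a b y : A} (hy : α.IsTwistedMul t a b y)
    (h : ∀ x ∈ α.ideal t⁻¹, α.act t (x * a) * b ∈ α.ideal s) : y ∈ α.ideal s := by
  obtain ⟨x, hx, hxy⟩ := α.exists_act_eq (α.star_mem hy.1)
  refine α.mem_of_star_mul_self ?_
  rw [← hxy, hy.2 x hx]
  exact h x hx

lemma IsTwistedMul.norm_le {t : G} {a b y : A} (hy : α.IsTwistedMul t a b y) :
    ‖y‖ ≤ ‖a‖ * ‖b‖ := by
  obtain ⟨x, hx, hxy⟩ := α.exists_act_eq (α.star_mem hy.1)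
  have hxn : ‖x‖ = ‖y‖ := by rw [← α.norm_act hx, hxy, norm_star]
  have h : ‖y‖ * ‖y‖ ≤ ‖y‖ * (‖a‖ * ‖b‖) := by
    rw [← CStarRing.norm_star_mul_self, ← hxy, hy.2 x hx, ← mul_assoc, ← hxn]
    calc ‖α.act t (x * a) * b‖ ≤ ‖α.act t (x * a)‖ * ‖b‖ := norm_mul_le _ _
      _ = ‖x * a‖ * ‖b‖ := by rw [α.norm_act (α.mul_mem_right _ _ _ hx)]
      _ ≤ ‖x‖ * ‖a‖ * ‖b‖ := by
        gcongr
        exact norm_mul_le _ _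
  by_cases h0 : ‖y‖ = 0
  · rw [h0]; positivity
  · exact le_of_mul_le_mul_left h (lt_of_le_of_ne (norm_nonneg _) (Ne.symm h0))

/-- The product `β_t(a) b`. -/
noncomputable def twistedMul (h : α.HasTwistedMul) (t : G) (a b : A) : A := (h t a b).choose

section TwistedMul

variable (h : α.HasTwistedMul)

lemma isTwistedMul (t : G) (a b : A) : α.IsTwistedMul t a b (twistedMul h t a b) :=
  (h t a b).choose_spec

lemma twistedMul_mem (t : G) (a b : A) : twistedMul h t a b ∈ α.ideal t := (isTwistedMul h t a b).1

lemma act_mul_twistedMul (t : G) (a b : A) {x : A} (hx : x ∈ α.ideal t⁻¹) :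
    α.act t x * twistedMul h t a b = α.act t (x * a) * b := (isTwistedMul h t a b).2 x hx

lemma twistedMul_eq {t : G} {a b y : A} (hy : α.IsTwistedMul t a b y) : twistedMul h t a b = y :=
  (isTwistedMul h t a b).unique hy

lemma twistedMul_add_left (t : G) (a a' b : A) :
    twistedMul h t (a + a') b = twistedMul h t a b + twistedMul h t a' b :=
  twistedMul_eq h ⟨add_mem (twistedMul_mem h t a b) (twistedMul_mem h t a' b), fun x hx => by
    rw [mul_add, act_mul_twistedMul h _ _ _ hx, act_mul_twistedMul h _ _ _ hx, mul_add,
      α.act_add t _ (α.mul_mem_right _ _ _ hx) _ (α.mul_mem_right _ _ _ hx), add_mul]⟩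

lemma twistedMul_add_right (t : G) (a b b' : A) :
    twistedMul h t a (b + b') = twistedMul h t a b + twistedMul h t a b' :=
  twistedMul_eq h ⟨add_mem (twistedMul_mem h t a b) (twistedMul_mem h t a b'), fun x hx => by
    rw [mul_add, act_mul_twistedMul h _ _ _ hx, act_mul_twistedMul h _ _ _ hx, mul_add]⟩

lemma twistedMul_smul_left (t : G) (c : ℂ) (a b : A) :
    twistedMul h t (c • a) b = c • twistedMul h t a b :=
  twistedMul_eq h ⟨Submodule.smul_mem _ _ (twistedMul_mem h t a b), fun x hx => by
    rw [mul_smul_comm, act_mul_twistedMul h _ _ _ hx, mul_smul_comm,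
      α.act_smul t _ _ (α.mul_mem_right _ _ _ hx), smul_mul_assoc]⟩

lemma twistedMul_smul_right (t : G) (c : ℂ) (a b : A) :
    twistedMul h t a (c • b) = c • twistedMul h t a b :=
  twistedMul_eq h ⟨Submodule.smul_mem _ _ (twistedMul_mem h t a b), fun x hx => by
    rw [mul_smul_comm, act_mul_twistedMul h _ _ _ hx, mul_smul_comm]⟩

lemma twistedMul_mul_right (t : G) (a b c : A) :
    twistedMul h t a (b * c) = twistedMul h t a b * c :=
  twistedMul_eq h ⟨α.mul_mem_right _ _ _ (twistedMul_mem h t a b), fun x hx => by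
    rw [← mul_assoc, act_mul_twistedMul h _ _ _ hx, mul_assoc]⟩

lemma twistedMul_one (a b : A) : twistedMul h 1 a b = a * b :=
  twistedMul_eq h ⟨α.mem_ideal_one _, fun x _ => by simp only [α.act_one, mul_assoc]⟩

lemma twistedMul_act (t : G) (a : A) {x : A} (hx : x ∈ α.ideal t⁻¹) :
    twistedMul h t a (α.act t x) = α.act t (a * x) :=
  twistedMul_eq h ⟨α.act_mem t _ (α.mul_mem_left _ _ _ hx), fun z hz => by
    rw [← α.act_mul t _ hz _ (α.mul_mem_left _ _ _ hx),
      ← α.act_mul t _ (α.mul_mem_right _ _ _ hz) _ hx, mul_assoc]⟩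

lemma norm_twistedMul_le (t : G) (a b : A) : ‖twistedMul h t a b‖ ≤ ‖a‖ * ‖b‖ :=
  (isTwistedMul h t a b).norm_le

/-- `β_t(β_s(a) b) c = β_{ts}(a) (β_t(b) c)`. -/
lemma twistedMul_twistedMul (s t : G) (a b c : A) :
    twistedMul h t (twistedMul h s a b) c = twistedMul h (t * s) a (twistedMul h t b c) := by
  refine α.eq_of_forall_act_mul_eq (s := s) (twistedMul_mem h _ _ _) ?_ ?_
    (twistedMul_mem h _ _ _) fun x hx hxs => ?_
  · refine (isTwistedMul h _ _ _).mem_of_forall fun x hx => α.mul_mem_right _ _ _ ?_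
    exact α.act_mem_mul (α.mul_mem_right _ _ _ hx) (α.mul_mem_left _ _ _ (twistedMul_mem h _ _ _))
  · exact (isTwistedMul h _ _ _).mem_of_forall fun x hx =>
      α.mul_mem_left _ _ _ (twistedMul_mem h _ _ _)
  · obtain ⟨w, hw, hwt, rfl⟩ := α.exists_act_eq_of_mem_mul (s := s⁻¹ * t⁻¹) hxs (by simpa using hx)
    have hws : w ∈ α.ideal (t * s)⁻¹ := by simpa using hwt
    rw [act_mul_twistedMul h _ _ _ hx, act_mul_twistedMul h _ _ _ hw, α.act_comp t s w hw hx,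
      act_mul_twistedMul h _ _ _ hws]
    have hwa : α.act s (w * a) ∈ α.ideal t⁻¹ := by
      simpa using α.act_mem_mul (α.mul_mem_right _ a _ hw) (α.mul_mem_right _ a _ hwt)
    rw [← act_mul_twistedMul h _ _ _ hwa, α.act_comp t s _ (α.mul_mem_right _ a _ hw) hwa]

/-- `β_s(α_t(a)) b = β_{st}(a) b` for `a ∈ A_{t⁻¹}`. -/
lemma twistedMul_act_left (s t : G) {a : A} (ha : a ∈ α.ideal t⁻¹) (b : A) :
    twistedMul h s (α.act t a) b = twistedMul h (s * t) a b := by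
  refine α.eq_of_forall_act_mul_eq (s := t) (twistedMul_mem h _ _ _) ?_ ?_
    (twistedMul_mem h _ _ _) fun x hx hxt => ?_
  · refine (isTwistedMul h _ _ _).mem_of_forall fun x hx => α.mul_mem_right _ _ _ ?_
    exact α.act_mem_mul (α.mul_mem_right _ _ _ hx) (α.mul_mem_left _ _ _ (α.act_mem t _ ha))
  · refine (isTwistedMul h _ _ _).mem_of_forall fun x hx => α.mul_mem_right _ _ _ ?_
    simpa using α.act_mem_mul (α.mul_mem_right _ a _ hx) (α.mul_mem_left _ x _ ha)
  · obtain ⟨w, hw, hws, rfl⟩ := α.exists_act_eq_of_mem_mul (s := t⁻¹ * s⁻¹) hxt (by simpa using hx)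
    have hws' : w ∈ α.ideal (s * t)⁻¹ := by simpa using hws
    have hwa : α.act t (w * a) ∈ α.ideal s⁻¹ := by
      simpa using α.act_mem_mul (α.mul_mem_right _ a _ hw) (α.mul_mem_right _ a _ hws)
    rw [act_mul_twistedMul h _ _ _ hx, α.act_comp s t w hw hx, act_mul_twistedMul h _ _ _ hws',
      ← α.act_mul t _ hw _ ha, α.act_comp s t _ (α.mul_mem_right _ a _ hw) hwa]

/-- The left and right multiplications by `β_t(a)` are compatible. -/
lemma star_twistedMul_mul (t : G) (a b c : A) :
    star (twistedMul h t (star a) (star b)) * c = b * twistedMul h t a c := by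
  have h₁ : star (twistedMul h t (star a) (star b)) * c ∈ α.ideal t :=
    α.mul_mem_right _ _ _ (α.star_mem (twistedMul_mem h _ _ _))
  have h₂ : b * twistedMul h t a c ∈ α.ideal t := α.mul_mem_left _ _ _ (twistedMul_mem h _ _ _)
  refine α.eq_of_forall_act_mul_eq (s := 1) h₁ (by simpa using h₁) h₂ (by simpa using h₂)
    fun x hx _ => ?_
  obtain ⟨w, hw, hwb⟩ := α.exists_act_eq (α.mul_mem_right _ b _ (α.act_mem t x hx))
  have hstar : twistedMul h t (star a) (star b) * star (α.act t x) = α.act t (star a * star w) := by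
    rw [← twistedMul_mul_right, ← star_mul, ← hwb, ← α.act_star t w hw,
      twistedMul_act h _ _ (α.star_mem hw)]
  rw [← mul_assoc, ← mul_assoc, ← hwb, act_mul_twistedMul h _ _ _ hw]
  congr 1
  rw [← star_star (α.act t x), ← star_mul, hstar, ← star_mul,
    α.act_star t _ (α.mul_mem_right _ _ _ hw), star_star]

end TwistedMul

end CStarPartialAction

namespace CStarPartialAction

variable {G : Type u} [Group G] {A : Type v} [NonUnitalCStarAlgebra A]
  {α : CStarPartialAction G A}

lemma hasTwistedMul_of_hasNS [PartialOrder A] [StarOrderedRing A] (hNS : HasNS α) :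
    α.HasTwistedMul := by
  intro t a b
  obtain ⟨ι, _, _, _, u, hu⟩ := exists_isApproxUnit (α.ideal t⁻¹) (α.ideal_closed t⁻¹)
    (α.mul_mem_left t⁻¹) (α.mul_mem_right t⁻¹)
  obtain ⟨y, hy⟩ := hNS t a b ι u hu
  have hua : ∀ i, u i * a ∈ α.ideal t⁻¹ := fun i => α.mul_mem_right _ _ _ (hu.mem i)
  refine ⟨y, (α.ideal_closed t).mem_of_tendsto hy (Filter.Eventually.of_forall fun i =>
    α.mul_mem_right _ _ _ (α.act_mem t _ (hua i))), fun x hx => ?_⟩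
  refine tendsto_nhds_unique (hy.const_mul (α.act t x)) ?_
  rw [tendsto_iff_norm_sub_tendsto_zero]
  have hlim := ((hu.approx _ (α.star_mem hx)).mul_const ‖a‖).mul_const ‖b‖
  simp only [zero_mul] at hlim
  refine squeeze_zero (fun _ => norm_nonneg _) (fun i => ?_) hlim
  have hxu : x * (u i * a) ∈ α.ideal t⁻¹ := α.mul_mem_left _ _ _ (hua i)
  have hxa : x * a ∈ α.ideal t⁻¹ := α.mul_mem_right _ _ _ hx
  have hnorm : ‖u i * star x - star x‖ = ‖x * u i - x‖ := by
    rw [← norm_star]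
    simp [(hu.nonneg i).isSelfAdjoint.star_eq]
  rw [← mul_assoc, ← α.act_mul t _ hx _ (hua i), ← sub_mul, ← α.act_sub hxu hxa, hnorm]
  calc ‖α.act t (x * (u i * a) - x * a) * b‖
      ≤ ‖α.act t (x * (u i * a) - x * a)‖ * ‖b‖ := norm_mul_le _ _
    _ = ‖(x * u i - x) * a‖ * ‖b‖ := by
      rw [α.norm_act (sub_mem hxu hxa), sub_mul, mul_assoc]
    _ ≤ ‖x * u i - x‖ * ‖a‖ * ‖b‖ := by
      gcongr
      exact norm_mul_le _ _

lemma HasTwistedMul.hasNS [PartialOrder A] [StarOrderedRing A] (h : α.HasTwistedMul) :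
    HasNS α := by
  intro t a b ι _ _ _ u hu
  obtain ⟨y, hy, hmul⟩ := h t a b
  obtain ⟨z, hz, rfl⟩ := α.exists_act_eq hy
  refine ⟨α.act t z, ?_⟩
  rw [tendsto_iff_norm_sub_tendsto_zero]
  refine (hu.approx z hz).congr fun i => ?_
  rw [← hmul _ (hu.mem i), ← α.act_mul t _ (hu.mem i) _ hz,
    ← α.act_sub (α.mul_mem_right _ _ _ (hu.mem i)) hz,
    α.norm_act (sub_mem (α.mul_mem_right _ _ _ (hu.mem i)) hz)]

/-- The members of an enveloping family of functions are the products `β_t(a) b`. -/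
lemma isTwistedMul_of_isEnvFamily {F : G → A → A → A}
    (hF : IsEnvFamily α.toAlgPartialAction F) (t : G) (a b : A) :
    α.IsTwistedMul t a b (F t a b) := by
  refine ⟨hF.mem t a b, fun x hx => ?_⟩
  rw [hF.cond2c, ← hF.cond5a t⁻¹ t a x hx, inv_mul_cancel, hF.F_one]

lemma isEnvFamily_unique {F F' : G → A → A → A}
    (hF : IsEnvFamily α.toAlgPartialAction F) (hF' : IsEnvFamily α.toAlgPartialAction F') :
    F = F' := by
  ext t a b
  exact (isTwistedMul_of_isEnvFamily hF t a b).unique (isTwistedMul_of_isEnvFamily hF' t a b)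

/-- An enveloping pair induces the enveloping family `F_t(a, b) = μ⁻¹(β_t(μ(a)) μ(b))`. -/
lemma exists_isEnvFamily_of_envPair {B : Type x} [NonUnitalRing B] [Module ℂ B]
    [SMulCommClass ℂ B B] [IsScalarTower ℂ B B] (E : EnvPair α.toAlgPartialAction B) :
    ∃ F : G → A → A → A, IsEnvFamily α.toAlgPartialAction F := by
  choose F hF using fun t a b => E.μ_mul_mem_left (E.β t (E.μ a)) (E.μ b) ⟨b, rfl⟩
  have hcomp : ∀ s t b, E.β s (E.β t b) = E.β (s * t) b := fun s t b => (E.β_comp s t b).symm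
  have hmem : ∀ t a b, F t a b ∈ α.ideal t := fun t a b => by
    obtain ⟨c, hc⟩ := E.μ_mul_mem_right (E.β t⁻¹ (E.μ b)) (E.μ a) ⟨a, rfl⟩
    have : E.μ (F t a b) ∈ E.μ '' (α.ideal t : Set A) := by
      rw [E.inter t]
      exact ⟨⟨_, rfl⟩, E.μ c, ⟨c, rfl⟩, by rw [hc, map_mul, hcomp, mul_inv_cancel, E.β_one, hF]⟩
    obtain ⟨y, hy, hyF⟩ := this
    exact E.μ_inj hyF ▸ hy
  have hact : ∀ t a b, E.μ (α.act t (F t⁻¹ a b)) = E.μ a * E.β t (E.μ b) := fun t a b => by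
    rw [← E.equivar t _ (hmem _ _ _), hF, map_mul, hcomp, mul_inv_cancel, E.β_one]
  have hone : ∀ a b, F 1 a b = a * b := fun a b =>
    E.μ_inj (by rw [hF, E.β_one, map_mul])
  refine ⟨F, ⟨hmem, ?_, ?_, ?_, ?_, hone, ?_, ?_, ?_, ?_, ?_, ?_, ?_, ?_, ?_⟩⟩
  · exact fun t a a' b => E.μ_inj (by simp only [hF, map_add, add_mul])
  · exact fun t a b b' => E.μ_inj (by simp only [hF, map_add, mul_add])
  · exact fun t c a b => E.μ_inj (by simp only [hF, map_smul, smul_mul_assoc])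
  · exact fun t c a b => E.μ_inj (by simp only [hF, map_smul, mul_smul_comm])
  · exact fun t a b c => E.μ_inj (by simp only [hF, map_mul, mul_assoc])
  · exact fun t a b c => E.μ_inj (by simp only [hact, map_mul, mul_assoc])
  · exact fun t a b c => E.μ_inj (by simp only [hF, hact, map_mul, mul_assoc])
  · exact fun s t a b c => E.μ_inj (by simp only [hF, map_mul, hcomp, mul_assoc])
  · intro s t a b c
    have hs := hact s⁻¹ a b
    rw [inv_inv] at hs
    exact E.μ_inj (by simp only [hF, hs, map_mul, hcomp, mul_assoc])
  · refine fun a => ⟨?_, fun ha => ?_⟩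
    · rintro rfl t b
      exact ⟨E.μ_inj (by simp only [hF, map_zero, zero_mul]),
        E.μ_inj (by simp only [hF, map_zero, mul_zero])⟩
    · have := (ha 1 (star a)).1
      rwa [hone, CStarRing.mul_star_self_eq_zero_iff] at this
  · exact fun s t b a ha => E.μ_inj (by rw [hF, hF, E.β_comp, E.equivar t a ha])
  · intro s t b a ha
    rw [← mul_inv_rev]
    exact E.μ_inj (by rw [hact, hact, E.β_comp, E.equivar t a ha])
  · rintro t a ⟨b, hb⟩
    have h := (hb 1 (star a)).1
    rw [hone, one_mul] at h
    have hstar : star a ∈ α.ideal t := α.mem_of_star_mul_self (by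
      rw [star_star, h]
      exact hmem _ _ _)
    simpa using α.star_mem hstar

/-- A C⋆-enveloping pair restricts to an algebraic enveloping pair with trivial annihilator on the
linear span of the translates of `μ(A)`. -/
lemma exists_algEnvelopingOf_annih_eq (E : CStarEnvelopingOf α) :
    ∃ E' : AlgEnvelopingOf α, letI := E'.ringI; annih E'.carrier = {0} := by
  obtain ⟨B, ⟨β, β_star, β_one, β_comp, μ, μ_star, μ_inj, -, hl, hr, inter, equivar, hdense⟩⟩ := E
  set T : Set B := ⋃ t : G, β t '' Set.range μ with hT
  have hmemT : ∀ t a, β t (μ a) ∈ T := fun t a => Set.mem_iUnion.mpr ⟨t, μ a, ⟨a, rfl⟩, rfl⟩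
  have hTmul : ∀ x ∈ T, ∀ y, x * y ∈ T := by
    intro x hx y
    obtain ⟨t, _, ⟨a, rfl⟩, rfl⟩ := Set.mem_iUnion.mp hx
    obtain ⟨c, hc⟩ := hr (β t⁻¹ y) (μ a) ⟨a, rfl⟩
    have h := hmemT t c
    rwa [hc, map_mul, ← β_comp, mul_inv_cancel, β_one] at h
  let S : NonUnitalSubalgebra ℂ B :=
    { Submodule.span ℂ T with
      mul_mem' := fun {x y} hx _ => by
        refine Submodule.span_induction (p := fun x _ => x * y ∈ Submodule.span ℂ T)
          (fun x hx => Submodule.subset_span (hTmul x hx y)) (by simp)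
          (fun x z _ _ hx hz => by rw [add_mul]; exact add_mem hx hz)
          (fun c x _ hx => by rw [smul_mul_assoc]; exact Submodule.smul_mem _ _ hx) hx }
  have hTS : T ⊆ S := Submodule.subset_span
  have hβT : ∀ t, ∀ x ∈ T, β t x ∈ T := by
    intro t x hx
    obtain ⟨s, _, ⟨a, rfl⟩, rfl⟩ := Set.mem_iUnion.mp hx
    rw [← β_comp]
    exact hmemT _ a
  have hβS : ∀ t, ∀ x ∈ S, β t x ∈ S := fun t x hx =>
    Submodule.span_induction (p := fun x _ => β t x ∈ S) (fun x hx => hTS (hβT t x hx))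
      (by rw [map_zero]; exact zero_mem S) (fun x y _ _ hx hy => by rw [map_add]; exact add_mem hx hy)
      (fun c x _ hx => by rw [map_smul]; exact S.toSubmodule.smul_mem c hx) hx
  have hμS : ∀ a, μ a ∈ S := fun a => hTS (by simpa [β_one] using hmemT 1 a)
  let μ' : A →ₙₐ[ℂ] S := NonUnitalAlgHom.codRestrict μ S hμS
  let β' : G → S →ₙₐ[ℂ] S := fun t =>
    NonUnitalAlgHom.codRestrict ((β t).comp (NonUnitalSubalgebraClass.subtype S)) S
      fun x => hβS t x x.2
  have hμ' : ∀ a, (μ' a : B) = μ a := fun a => rfl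
  have hβ' : ∀ t x, (β' t x : B) = β t x := fun t x => rfl
  refine ⟨⟨S, ⟨β', fun b => ?_, fun s t b => ?_, μ', fun a b hab => ?_, ?_, ?_, fun t => ?_,
    fun t a ha => ?_, ?_⟩⟩, ?_⟩
  · exact Subtype.ext (by rw [hβ', β_one])
  · exact Subtype.ext (by rw [hβ', hβ', hβ', β_comp])
  · exact μ_inj (congrArg Subtype.val hab)
  · rintro b _ ⟨a, rfl⟩
    obtain ⟨c, hc⟩ := hl b (μ a) ⟨a, rfl⟩
    exact ⟨c, Subtype.ext hc⟩
  · rintro b _ ⟨a, rfl⟩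
    obtain ⟨c, hc⟩ := hr b (μ a) ⟨a, rfl⟩
    exact ⟨c, Subtype.ext hc⟩
  · ext y
    have hy := Set.ext_iff.mp (inter t) y
    simp only [Set.mem_image, Set.mem_inter_iff, Set.mem_range, exists_exists_eq_and] at hy ⊢
    simpa only [Subtype.ext_iff, hμ', hβ'] using hy
  · exact Subtype.ext (equivar t a ha)
  · rw [eq_top_iff]
    rintro ⟨x, hx⟩ -
    refine Submodule.span_induction (p := fun x hx => (⟨x, hx⟩ : S) ∈
      Submodule.span ℂ (⋃ t : G, β' t '' Set.range μ')) (fun x hx => ?_) (zero_mem _)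
      (fun x y _ _ hx hy => add_mem hx hy) (fun c x _ hx => Submodule.smul_mem _ c hx) hx
    obtain ⟨t, _, ⟨a, rfl⟩, rfl⟩ := Set.mem_iUnion.mp hx
    exact Submodule.subset_span (Set.mem_iUnion.mpr ⟨t, μ' a, ⟨a, rfl⟩, rfl⟩)
  · refine Set.eq_singleton_iff_unique_mem.mpr ⟨fun c => ⟨zero_mul c, mul_zero c⟩, fun b hb => ?_⟩
    have hzero : ∀ y : B, (b : B) * y = 0 := by
      have hclosed : IsClosed {y : B | (b : B) * y = 0} :=
        isClosed_eq (continuous_const.mul continuous_id) continuous_const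
      have hsub : closure (S : Set B) ⊆ {y : B | (b : B) * y = 0} :=
        hclosed.closure_subset_iff.mpr fun y hy => congrArg Subtype.val (hb ⟨y, hy⟩).1
      exact fun y => hsub (hdense y)
    exact Subtype.ext ((CStarRing.mul_star_self_eq_zero_iff _).mp (hzero (star b)))

end CStarPartialAction

section Globalization

variable {G : Type u} [Group G] {A : Type v} [NonUnitalCStarAlgebra A]

/-- A global action `β` on a C⋆-algebra `M` together with a suitable embedding of `A` into `M`
yields a C⋆-enveloping pair on the closed linear span of the translates of `A`. -/
lemma CStarPartialAction.nonempty_cstarEnvelopingOf_of_embedding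
    (α : CStarPartialAction G A) {M : Type (max u v)} [NonUnitalCStarAlgebra M]
    (β : G → M →⋆ₙₐ[ℂ] M) (β_one : ∀ b, β 1 b = b) (β_comp : ∀ s t b, β (s * t) b = β s (β t b))
    (μ : A →⋆ₙₐ[ℂ] M) (μ_inj : Function.Injective μ)
    (hmul : ∀ t a b, β t (μ a) * μ b ∈ Set.range μ)
    (inter : ∀ t, μ '' (α.ideal t : Set A) = Set.range μ ∩ (β t '' Set.range μ))
    (equivar : ∀ t, ∀ a ∈ α.ideal t⁻¹, β t (μ a) = μ (α.act t a)) :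
    Nonempty (CStarEnvelopingOf α) := by
  have hclosed : IsClosed (Set.range μ) :=
    (NonUnitalStarAlgHom.isometry μ μ_inj).isClosedEmbedding.isClosed_range
  set T : Set M := ⋃ t : G, β t '' Set.range μ with hT
  have hmemT : ∀ t a, β t (μ a) ∈ T := fun t a => Set.mem_iUnion.mpr ⟨t, μ a, ⟨a, rfl⟩, rfl⟩
  have hTmul : ∀ x ∈ T, ∀ y ∈ T, x * y ∈ T := by
    intro x hx y hy
    obtain ⟨s, _, ⟨a, rfl⟩, rfl⟩ := Set.mem_iUnion.mp hx
    obtain ⟨t, _, ⟨b, rfl⟩, rfl⟩ := Set.mem_iUnion.mp hy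
    obtain ⟨c, hc⟩ := hmul (t⁻¹ * s) a b
    have h := hmemT t c
    rwa [hc, map_mul, ← β_comp, mul_inv_cancel_left] at h
  have hTstar : ∀ x ∈ T, star x ∈ T := by
    intro x hx
    obtain ⟨s, _, ⟨a, rfl⟩, rfl⟩ := Set.mem_iUnion.mp hx
    rw [← map_star, ← map_star]
    exact hmemT _ _
  have hβT : ∀ t, ∀ x ∈ T, β t x ∈ T := by
    intro t x hx
    obtain ⟨s, _, ⟨a, rfl⟩, rfl⟩ := Set.mem_iUnion.mp hx
    rw [← β_comp]
    exact hmemT _ a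
  let S₀ : NonUnitalStarSubalgebra ℂ M :=
    { Submodule.span ℂ T with
      mul_mem' := fun {x y} hx hy => by
        refine Submodule.span_induction₂ (p := fun x y _ _ => x * y ∈ Submodule.span ℂ T)
          (fun x y hx hy => Submodule.subset_span (hTmul x hx y hy)) (by simp) (by simp)
          (fun x y z _ _ _ hx hy => by rw [add_mul]; exact add_mem hx hy)
          (fun x y z _ _ _ hx hy => by rw [mul_add]; exact add_mem hx hy)
          (fun c x y _ _ hx => by rw [smul_mul_assoc]; exact Submodule.smul_mem _ _ hx)
          (fun c x y _ _ hx => by rw [mul_smul_comm]; exact Submodule.smul_mem _ _ hx) hx hy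
      star_mem' := fun {x} hx => by
        refine Submodule.span_induction (p := fun x _ => star x ∈ Submodule.span ℂ T)
          (fun x hx => Submodule.subset_span (hTstar x hx)) (by simp)
          (fun x y _ _ hx hy => by rw [star_add]; exact add_mem hx hy)
          (fun c x _ hx => by rw [star_smul]; exact Submodule.smul_mem _ _ hx) hx }
  have hTS₀ : T ⊆ S₀ := Submodule.subset_span
  have hβS₀ : ∀ t, ∀ x ∈ S₀, β t x ∈ S₀ := fun t x hx =>
    Submodule.span_induction (p := fun x _ => β t x ∈ S₀) (fun x hx => hTS₀ (hβT t x hx))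
      (by rw [map_zero]; exact zero_mem S₀)
      (fun x y _ _ hx hy => by rw [map_add]; exact add_mem hx hy)
      (fun c x _ hx => by rw [map_smul]; exact SMulMemClass.smul_mem c hx) hx
  let S := S₀.topologicalClosure
  have hS₀S : S₀ ≤ S := S₀.le_topologicalClosure
  have hSclosed : IsClosed (S : Set M) := S₀.isClosed_topologicalClosure
  have hβS : ∀ t, ∀ x ∈ S, β t x ∈ S := fun t x hx =>
    map_mem_closure (AddMonoidHomClass.continuous_of_bound (β t) 1
      (by simpa using NonUnitalStarAlgHom.norm_apply_le (β t))) hx (hβS₀ t)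
  have hμS : ∀ a, μ a ∈ S := fun a => hS₀S (hTS₀ (by simpa [β_one] using hmemT 1 a))
  have hideal : ∀ x ∈ S, ∀ a, x * μ a ∈ Set.range μ := by
    intro x hx a
    have hc : IsClosed {x : M | x * μ a ∈ Set.range μ} :=
      hclosed.preimage (continuous_id.mul continuous_const)
    refine hc.closure_subset_iff.mpr (fun x hx => ?_) hx
    refine Submodule.span_induction (p := fun x _ => x * μ a ∈ Set.range μ) (fun x hx => ?_)
      ⟨0, by simp⟩ ?_ ?_ hx
    · obtain ⟨t, _, ⟨b, rfl⟩, rfl⟩ := Set.mem_iUnion.mp hx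
      exact hmul t b a
    · rintro x y - - ⟨c, hc⟩ ⟨d, hd⟩
      exact ⟨c + d, by rw [map_add, hc, hd, add_mul]⟩
    · rintro k x - ⟨c, hc⟩
      exact ⟨k • c, by rw [map_smul, hc, smul_mul_assoc]⟩
  let μ' : A →⋆ₙₐ[ℂ] S := NonUnitalStarAlgHom.codRestrict μ S hμS
  let β' : G → S →⋆ₙₐ[ℂ] S := fun t =>
    NonUnitalStarAlgHom.codRestrict ((β t).comp (NonUnitalStarSubalgebraClass.subtype S)) S
      fun x => hβS t x x.2
  have hμ' : ∀ a, (μ' a : M) = μ a := fun a => rfl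
  have hβ' : ∀ t x, (β' t x : M) = β t x := fun t x => rfl
  refine ⟨⟨S, ⟨fun t => (β' t : S →ₙₐ[ℂ] S), fun t b => map_star (β' t) b, fun b => ?_,
    fun s t b => ?_, (μ' : A →ₙₐ[ℂ] S), fun a => map_star μ' a, fun a b hab => ?_, ?_, ?_, ?_,
    fun t => ?_, fun t a ha => ?_, fun x => ?_⟩⟩⟩
  · exact Subtype.ext (β_one b)
  · exact Subtype.ext (β_comp s t b)
  · exact μ_inj (congrArg Subtype.val hab)
  · have : Set.range μ' = Subtype.val ⁻¹' Set.range μ := by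
      ext x
      simp only [Set.mem_range, Set.mem_preimage, Subtype.ext_iff, hμ']
    change IsClosed (Set.range μ')
    rw [this]
    exact hclosed.preimage continuous_subtype_val
  · rintro b _ ⟨a, rfl⟩
    obtain ⟨c, hc⟩ := hideal b b.2 a
    exact ⟨c, Subtype.ext hc⟩
  · rintro b _ ⟨a, rfl⟩
    obtain ⟨c, hc⟩ := hideal (star b : M) (StarMemClass.star_mem b.2) (star a)
    exact ⟨star c, Subtype.ext ((map_star μ c).trans (by
      rw [hc, star_mul, star_star, map_star, star_star]; rfl))⟩
  · ext y
    have hy := Set.ext_iff.mp (inter t) y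
    change y ∈ μ' '' _ ↔ y ∈ Set.range μ' ∩ β' t '' Set.range μ'
    simp only [Set.mem_image, Set.mem_inter_iff, Set.mem_range, exists_exists_eq_and] at hy ⊢
    simpa only [Subtype.ext_iff, hμ', hβ'] using hy
  · exact Subtype.ext (equivar t a ha)
  · rw [closure_subtype]
    refine closure_mono (fun y hy => ?_) x.2
    refine Submodule.span_induction (p := fun y _ => y ∈ Subtype.val ''
      (Submodule.span ℂ (⋃ t : G, β' t '' Set.range μ') : Set S)) (fun y hy => ?_)
      ⟨0, zero_mem _, rfl⟩ ?_ ?_ hy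
    · obtain ⟨t, _, ⟨a, rfl⟩, rfl⟩ := Set.mem_iUnion.mp hy
      exact ⟨β' t (μ' a), Submodule.subset_span (Set.mem_iUnion.mpr ⟨t, μ' a, ⟨a, rfl⟩, rfl⟩), rfl⟩
    · rintro _ _ - - ⟨y, hy, rfl⟩ ⟨z, hz, rfl⟩
      exact ⟨y + z, add_mem hy hz, rfl⟩
    · rintro c _ - ⟨y, hy, rfl⟩
      exact ⟨c • y, Submodule.smul_mem _ c hy, rfl⟩

open scoped ENNReal MultiplierAlgebra

/-- The action of `G` on bounded functions `G → M` by right translation of the argument. -/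
noncomputable def lpTranslate {M : Type w} [NonUnitalCStarAlgebra M] (t : G) :
    lp (fun _ : G => M) ∞ →⋆ₙₐ[ℂ] lp (fun _ : G => M) ∞ where
  toFun f := ⟨fun s => f (s * t), memℓp_infty ⟨‖f‖, by
    rintro _ ⟨s, rfl⟩
    exact lp.norm_apply_le_norm ENNReal.top_ne_zero f (s * t)⟩⟩
  map_smul' _ _ := rfl
  map_zero' := rfl
  map_add' _ _ := rfl
  map_mul' _ _ := rfl
  map_star' _ := rfl

lemma lpTranslate_apply {M : Type w} [NonUnitalCStarAlgebra M] (t s : G)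
    (f : lp (fun _ : G => M) ∞) : lpTranslate t f s = f (s * t) := rfl

namespace CStarPartialAction

variable {α : CStarPartialAction G A} (h : α.HasTwistedMul)

/-- `β_t(a)` as a multiplier of `A`. -/
noncomputable def twistedMultiplier (t : G) (a : A) : 𝓜(ℂ, A) where
  fst := LinearMap.mkContinuous
    { toFun := twistedMul h t a
      map_add' := twistedMul_add_right h t a
      map_smul' := fun c b => twistedMul_smul_right h t c a b } ‖a‖ (norm_twistedMul_le h t a)
  snd := LinearMap.mkContinuous
    { toFun := fun b => star (twistedMul h t (star a) (star b))
      map_add' := fun b b' => by rw [star_add, twistedMul_add_right, star_add]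
      map_smul' := fun c b => by
        rw [star_smul, twistedMul_smul_right, star_smul, star_star, RingHom.id_apply] } ‖a‖
    (fun b => by
      change ‖star (twistedMul h t (star a) (star b))‖ ≤ ‖a‖ * ‖b‖
      simpa using norm_twistedMul_le h t (star a) (star b))
  central b c := star_twistedMul_mul h t a b c

lemma norm_twistedMultiplier_le (t : G) (a : A) : ‖twistedMultiplier h t a‖ ≤ ‖a‖ := by
  rw [← DoubleCentralizer.norm_fst]
  exact ContinuousLinearMap.opNorm_le_bound _ (norm_nonneg a) (norm_twistedMul_le h t a)

/-- A multiplier of a C⋆-algebra is determined by its left multiplication. -/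
lemma multiplier_ext {m n : 𝓜(ℂ, A)} (hmn : ∀ b, m.fst b = n.fst b) : m = n := by
  rw [← sub_eq_zero, ← norm_eq_zero, ← DoubleCentralizer.norm_fst, norm_eq_zero,
    DoubleCentralizer.sub_fst, sub_eq_zero]
  exact ContinuousLinearMap.ext hmn

/-- The embedding of `A` into the bounded multiplier-valued functions on `G`, sending `a` to
`t ↦ β_t(a)`. -/
noncomputable def lpEmbedding : A →⋆ₙₐ[ℂ] lp (fun _ : G => 𝓜(ℂ, A)) ∞ where
  toFun a := ⟨fun t => twistedMultiplier h t a, memℓp_infty ⟨‖a‖, by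
    rintro _ ⟨t, rfl⟩
    exact norm_twistedMultiplier_le h t a⟩⟩
  map_smul' c a := lp.ext <| funext fun t => multiplier_ext fun b => twistedMul_smul_left h t c a b
  map_zero' := lp.ext <| funext fun t => multiplier_ext fun b => by
    have hz := twistedMul_smul_left h t (0 : ℂ) 0 b
    rw [zero_smul, zero_smul] at hz
    exact hz
  map_add' a a' := lp.ext <| funext fun t => multiplier_ext fun b => twistedMul_add_left h t a a' b
  map_mul' a a' := lp.ext <| funext fun t => multiplier_ext fun b => by
    have hm := twistedMul_twistedMul h 1 t a a' b
    rw [twistedMul_one, mul_one] at hm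
    exact hm
  map_star' a := lp.ext <| funext fun t => multiplier_ext fun b => by
    change twistedMul h t (star a) b = star (star (twistedMul h t (star a) (star (star b))))
    rw [star_star, star_star]

lemma lpEmbedding_apply_fst (t : G) (a b : A) :
    (lpEmbedding h a t).fst b = twistedMul h t a b := rfl

lemma HasTwistedMul.nonempty_cstarEnvelopingOf (h : α.HasTwistedMul) :
    Nonempty (CStarEnvelopingOf α) := by
  have hequivar : ∀ t, ∀ a ∈ α.ideal t⁻¹,
      lpTranslate t (lpEmbedding h a) = lpEmbedding h (α.act t a) := fun t a ha =>
    lp.ext <| funext fun s => multiplier_ext fun b => (twistedMul_act_left h s t ha b).symm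
  have hone : ∀ a b, (lpEmbedding h a 1).fst b = a * b := twistedMul_one h
  refine α.nonempty_cstarEnvelopingOf_of_embedding lpTranslate (fun f => ?_) (fun s t f => ?_)
    (lpEmbedding h) (fun a b hab => ?_) (fun t a b => ?_) (fun t => ?_) hequivar
  · exact lp.ext <| funext fun s => by rw [lpTranslate_apply, mul_one]
  · exact lp.ext <| funext fun r => by simp only [lpTranslate_apply, mul_assoc]
  · have hc : (a - b) * star (a - b) = 0 := by
      rw [sub_mul, ← hone, ← hone, hab, sub_self]
    exact sub_eq_zero.mp ((CStarRing.mul_star_self_eq_zero_iff _).mp hc)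
  · exact ⟨twistedMul h t a b, lp.ext <| funext fun s => multiplier_ext fun c =>
      twistedMul_twistedMul h t s a b c⟩
  · ext f
    constructor
    · rintro ⟨a, ha, rfl⟩
      obtain ⟨b, hb, rfl⟩ := α.exists_act_eq ha
      exact ⟨⟨_, rfl⟩, _, ⟨b, rfl⟩, hequivar t b hb⟩
    · rintro ⟨⟨a, rfl⟩, _, ⟨b, rfl⟩, hab⟩
      refine ⟨a, ?_, rfl⟩
      have hstar : star a ∈ α.ideal t := α.mem_of_star_mul_self (by
        rw [star_star, ← hone, ← hab, lpTranslate_apply, one_mul, lpEmbedding_apply_fst]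
        exact twistedMul_mem h _ _ _)
      simpa using α.star_mem hstar

end CStarPartialAction

end Globalization

/-- **Theorem 2.5.** For a C*-partial action `α` of a discrete group `G` on a
C*-algebra `A`, the following are equivalent: (1) `α` has a C*-enveloping pair; (2) `α` has an
enveloping pair with trivial annihilator; (3) `α` has a (unique) enveloping family of
functions; (4) `α` has an enveloping pair; (5) `α` has property (NS). -/
theorem cstar_envPair_tfae
    {G : Type u} [Group G] {A : Type v} [NonUnitalCStarAlgebra A]
    [PartialOrder A] [StarOrderedRing A]
    (α : CStarPartialAction G A) :
    (Nonempty (CStarEnvelopingOf α) ↔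
      (∃ E : AlgEnvelopingOf α, letI := E.ringI; annih E.carrier = {0})) ∧
    ((∃ E : AlgEnvelopingOf α, letI := E.ringI; annih E.carrier = {0}) ↔
      (∃! F : G → A → A → A, IsEnvFamily α.toAlgPartialAction F)) ∧
    ((∃! F : G → A → A → A, IsEnvFamily α.toAlgPartialAction F) ↔
      Nonempty (AlgEnvelopingOf α)) ∧
    (Nonempty (AlgEnvelopingOf α) ↔ HasNS α) := by
  have h_annih : Nonempty (CStarEnvelopingOf α) →
      ∃ E : AlgEnvelopingOf α, letI := E.ringI; annih E.carrier = {0} :=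
    fun ⟨E⟩ => CStarPartialAction.exists_algEnvelopingOf_annih_eq E
  have h_alg : (∃ E : AlgEnvelopingOf α, letI := E.ringI; annih E.carrier = {0}) →
      Nonempty (AlgEnvelopingOf α) := fun ⟨E, _⟩ => ⟨E⟩
  have h_family : Nonempty (AlgEnvelopingOf α) →
      ∃! F : G → A → A → A, IsEnvFamily α.toAlgPartialAction F := by
    rintro ⟨⟨B, pair⟩⟩
    obtain ⟨F, hF⟩ := CStarPartialAction.exists_isEnvFamily_of_envPair pair
    exact ⟨F, hF, fun F' hF' => CStarPartialAction.isEnvFamily_unique hF' hF⟩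
  have h_twisted : (∃! F : G → A → A → A, IsEnvFamily α.toAlgPartialAction F) → α.HasTwistedMul :=
    fun ⟨F, hF, _⟩ t a b => ⟨F t a b, CStarPartialAction.isTwistedMul_of_isEnvFamily hF t a b⟩
  have h_cstar := fun h => (h_twisted h).nonempty_cstarEnvelopingOf
  exact ⟨⟨h_annih, fun h => h_cstar (h_family (h_alg h))⟩,
    ⟨fun h => h_family (h_alg h), fun h => h_annih (h_cstar h)⟩,
    ⟨fun h => h_alg (h_annih (h_cstar h)), h_family⟩, fun h => (h_twisted (h_family h)).hasNS,
    fun h => h_alg (h_annih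
      (CStarPartialAction.hasTwistedMul_of_hasNS h).nonempty_cstarEnvelopingOf)⟩
end

section
/- Let α be a C*-partial action of a discrete group G on a C*-algebra A such that every ideal A_t is unital, with unit 1_t. Then for all a ∈ A and r, t ∈ G: ‖α_{rt}(1_{t⁻¹r⁻¹} a) − α_r(1_{r⁻¹} a)‖² ≤ 2‖a‖·( ‖a − α_{t⁻¹}(1_t a)‖ + ‖a − α_t(1_{t⁻¹} a)‖ ). -/
set_option linter.unusedSectionVars false
set_option linter.unusedVariables false

universe u v w x y

section UnitalIdeals

variable {G : Type u} [Group G] {A : Type v} [NonUnitalCStarAlgebra A]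
  (α : CStarPartialAction G A) (one : G → A)

/-- `one t` is a two-sided unit of the ideal `A_t`, for every `t`. -/
def IsIdealUnits : Prop :=
  ∀ t : G, one t ∈ α.ideal t ∧ ∀ x ∈ α.ideal t, one t * x = x ∧ x * one t = x

namespace IsIdealUnits

variable {α one}

theorem commute (h : IsIdealUnits α one) (t : G) (x : A) : one t * x = x * one t := by
  have h₁ := ((h t).2 _ (α.mul_mem_right t x _ (h t).1)).2
  have h₂ := ((h t).2 _ (α.mul_mem_left t x _ (h t).1)).1
  rw [← h₁, mul_assoc, h₂]

theorem mul_mem (h : IsIdealUnits α one) (t : G) (x : A) : one t * x ∈ α.ideal t :=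
  α.mul_mem_right t x _ (h t).1

theorem star_one (h : IsIdealUnits α one) (t : G) : star (one t) = one t := by
  have hp : one t * one t = one t := ((h t).2 _ (h t).1).1
  have hc := h.commute t (star (one t))
  have hps : star (one t) * star (one t) = star (one t) := by rw [← star_mul, hp]
  have hz : one t - star (one t) * one t = 0 := by
    rw [← CStarRing.star_mul_self_eq_zero_iff]
    have e₁ : star (one t) * (star (one t) * one t) = star (one t) * one t := by
      rw [← mul_assoc, hps]
    have e₂ : star (one t) * one t * one t = star (one t) * one t := by rw [mul_assoc, hp]
    have e₃ : star (one t) * one t * (star (one t) * one t) = star (one t) * one t := by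
      rw [mul_assoc, ← mul_assoc (one t), hc, e₂, e₁]
    simp only [star_sub, star_mul, star_star, sub_mul, mul_sub, e₁, e₂, e₃, sub_self]
  have hq : one t = star (one t) * one t := sub_eq_zero.mp hz
  rw [hq, star_mul, star_star]

theorem act_one_mul_one (h : IsIdealUnits α one) (t u : G) :
    α.act t (one t⁻¹ * one u) = one t * one (t * u) := by
  have hmem : one t⁻¹ * one u ∈ (α.ideal t⁻¹ : Set A) ∩ (α.ideal u : Set A) :=
    ⟨h.mul_mem _ _, α.mul_mem_left _ _ _ (h u).1⟩
  have hL : α.act t (one t⁻¹ * one u) ∈ (α.ideal t : Set A) ∩ (α.ideal (t * u) : Set A) := by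
    rw [← α.act_image u t]
    exact Set.mem_image_of_mem _ hmem
  have hR : one t * one (t * u) ∈ (α.ideal t : Set A) ∩ (α.ideal (t * u) : Set A) :=
    ⟨h.mul_mem _ _, α.mul_mem_left _ _ _ (h _).1⟩
  have hR' := hR
  rw [← α.act_image u t] at hR'
  obtain ⟨w, hw, hwR⟩ := hR'
  have h₁ : α.act t (one t⁻¹ * one u) * (one t * one (t * u)) = one t * one (t * u) := by
    rw [← hwR, ← α.act_mul t _ hmem.1 _ hw.1, mul_assoc, ((h u).2 w hw.2).1,
      ((h t⁻¹).2 w hw.1).1]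
  rw [← h₁, ← mul_assoc, ((h t).2 _ hL.1).2, ((h (t * u)).2 _ hL.2).2]

theorem one_mul_act (h : IsIdealUnits α one) (t u : G) (a : A) :
    one (t * u) * α.act t (one t⁻¹ * a) = α.act t (one u * (one t⁻¹ * a)) := by
  have e₁ : one u * (one t⁻¹ * a) = one t⁻¹ * one u * (one t⁻¹ * a) := by
    rw [mul_assoc, ((h t⁻¹).2 _ (α.mul_mem_left t⁻¹ (one u) _ (h.mul_mem t⁻¹ a))).1]
  rw [e₁, α.act_mul t _ (h.mul_mem _ _) _ (h.mul_mem _ _), h.act_one_mul_one, mul_assoc,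
    ((h t).2 _ (α.mul_mem_left t _ _ (α.act_mem t _ (h.mul_mem _ a)))).1]

/-- The *-endomorphism `a ↦ α_t(1_{t⁻¹} a)` of `A`. -/
def extend (h : IsIdealUnits α one) (t : G) : A →⋆ₙₐ[ℂ] A where
  toFun a := α.act t (one t⁻¹ * a)
  map_smul' c a := by
    simpa [mul_smul_comm] using α.act_smul t c _ (h.mul_mem t⁻¹ a)
  map_zero' := by
    simpa using α.act_smul t 0 0 (zero_mem _)
  map_add' a b := by
    rw [mul_add, α.act_add t _ (h.mul_mem _ _) _ (h.mul_mem _ _)]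
  map_mul' a b := by
    rw [← α.act_mul t _ (h.mul_mem _ _) _ (h.mul_mem _ _), mul_assoc, ← mul_assoc a,
      ← h.commute t⁻¹ a, mul_assoc, ((h t⁻¹).2 _ (h.mul_mem t⁻¹ (a * b))).1]
  map_star' a := by
    rw [← α.act_star t _ (h.mul_mem _ _), star_mul, h.star_one, h.commute]

theorem extend_apply (h : IsIdealUnits α one) (t : G) (a : A) :
    h.extend t a = α.act t (one t⁻¹ * a) := rfl

theorem extend_mem (h : IsIdealUnits α one) (t : G) (a : A) : h.extend t a ∈ α.ideal t :=
  α.act_mem t _ (h.mul_mem _ a)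

theorem extend_extend (h : IsIdealUnits α one) (s t : G) (a : A) :
    h.extend s (h.extend t a) = one s * h.extend (s * t) a := by
  have e₁ := h.one_mul_act t (t⁻¹ * s⁻¹) a
  rw [mul_inv_cancel_left] at e₁
  have e₂ := h.one_mul_act (s * t) t⁻¹ a
  rw [mul_inv_cancel_right, mul_inv_rev] at e₂
  have e₃ : one (t⁻¹ * s⁻¹) * (one t⁻¹ * a) = one t⁻¹ * (one (t⁻¹ * s⁻¹) * a) := by
    rw [← mul_assoc, h.commute, mul_assoc]
  simp only [extend_apply, mul_inv_rev]
  rw [e₂, ← e₃, e₁]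
  refine α.act_comp s t _ (α.mul_mem_left _ _ _ (h.mul_mem _ a)) ?_
  rw [← e₁]
  exact h.mul_mem _ _

theorem norm_star_extend_mul_sub_le (h : IsIdealUnits α one) (s t : G) (a : A) :
    ‖star (h.extend s a) * (h.extend s a - h.extend (s * t) a)‖ ≤
      ‖a‖ * ‖a - h.extend t a‖ := by
  have e : star (h.extend s a) * (h.extend s a - h.extend (s * t) a) =
      h.extend s (star a * (a - h.extend t a)) := by
    have hs : star (h.extend s a) * one s = star (h.extend s a) := by
      rw [← map_star]
      exact ((h s).2 _ (h.extend_mem s _)).2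
    rw [map_mul, map_sub, map_star, h.extend_extend, mul_sub, mul_sub, ← mul_assoc _ (one s), hs]
  calc _ ≤ ‖star a * (a - h.extend t a)‖ := e ▸ NonUnitalStarAlgHom.norm_apply_le _ _
    _ ≤ ‖star a‖ * ‖a - h.extend t a‖ := norm_mul_le _ _
    _ = _ := by rw [norm_star]

theorem norm_extend_sub_sq_le (h : IsIdealUnits α one) (r t : G) (a : A) :
    ‖h.extend (r * t) a - h.extend r a‖ ^ 2 ≤
      ‖a‖ * (‖a - h.extend t⁻¹ a‖ + ‖a - h.extend t a‖) := by
  have h₁ := h.norm_star_extend_mul_sub_le (r * t) t⁻¹ a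
  rw [mul_inv_cancel_right] at h₁
  have h₂ := h.norm_star_extend_mul_sub_le r t a
  rw [sq, ← CStarRing.norm_star_mul_self, mul_add]
  refine le_trans (le_of_eq_of_le ?_ (norm_add_le _ _)) (add_le_add h₁ h₂)
  congr 1
  simp only [star_sub, sub_mul, mul_sub]
  abel

end IsIdealUnits

end UnitalIdeals

/-- If every ideal `A_t` of a C*-partial action is unital with unit `1_t`,
then for all `a ∈ A` and `r, t ∈ G`,
`‖α_{rt}(1_{t⁻¹r⁻¹} a) − α_r(1_{r⁻¹} a)‖² ≤ 2‖a‖(‖a − α_{t⁻¹}(1_t a)‖ + ‖a − α_t(1_{t⁻¹} a)‖)`. -/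
theorem norm_sq_estimate_of_unital_ideals
    {G : Type u} [Group G] {A : Type v} [NonUnitalCStarAlgebra A]
    (α : CStarPartialAction G A) (one : G → A)
    (hone : ∀ t : G, one t ∈ α.ideal t ∧ ∀ x ∈ α.ideal t, one t * x = x ∧ x * one t = x)
    (a : A) (r t : G) :
    ‖α.act (r * t) (one (t⁻¹ * r⁻¹) * a) - α.act r (one r⁻¹ * a)‖ ^ 2 ≤
      2 * ‖a‖ * (‖a - α.act t⁻¹ (one t * a)‖ + ‖a - α.act t (one t⁻¹ * a)‖) := by
  have h : IsIdealUnits α one := hone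
  have key := h.norm_extend_sub_sq_le r t a
  simp only [IsIdealUnits.extend_apply, mul_inv_rev, inv_inv] at key
  refine key.trans (mul_le_mul_of_nonneg_right ?_ (by positivity))
  linarith [norm_nonneg a]
end

section
/- Let α be a partial action of a group G on a k-algebra A with an enveloping family of functions (F_t)_{t∈G}, and define μ : A → M(F(G,A)) by [μ(a)f](r) = F_{r⁻¹}(a, f(r)) and [fμ(a)](r) = α_{r⁻¹}(F_r(f(r), a)). Then μ(a) is a multiplier for each a, μ is an injective algebra homomorphism, and for all a, b ∈ A and s, t ∈ G one has Ad_t(μ(a))·Ad_s(μ(b)) = Ad_s(μ(F_{s⁻¹t}(a,b))). -/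
set_option linter.unusedSectionVars false
set_option linter.unusedVariables false

universe u v w x y

section PartialActionPrelim

variable (k : Type u) [CommRing k] (G : Type v) [Group G] (A : Type w)
  [NonUnitalRing A] [Module k A] [SMulCommClass k A A] [IsScalarTower k A A]

variable {k G A}

/-- An isomorphism of enveloping pairs: an algebra isomorphism `φ` intertwining the global
actions with `φ ∘ μ = ν`. -/
def IsEnvPairIso {α : AlgPartialAction k G A} {B : Type x} [NonUnitalRing B]
    [Module k B] [SMulCommClass k B B] [IsScalarTower k B B]
    {C : Type y} [NonUnitalRing C] [Module k C] [SMulCommClass k C C] [IsScalarTower k C C]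
    (P : EnvPair α B) (Q : EnvPair α C) (φ : B → C) : Prop :=
  Function.Bijective φ ∧ (∀ x y : B, φ (x + y) = φ x + φ y) ∧
    (∀ x y : B, φ (x * y) = φ x * φ y) ∧ (∀ (c : k) (x : B), φ (c • x) = c • φ x) ∧
    (∀ (t : G) (b : B), φ (P.β t b) = Q.β t (φ b)) ∧ ∀ a : A, φ (P.μ a) = Q.μ a

end PartialActionPrelim

section MultiplierPrelim

variable (k : Type u) [CommRing k] (M : Type x) [NonUnitalRing M]
  [Module k M] [SMulCommClass k M M] [IsScalarTower k M M]

/-- A multiplier of a non-unital algebra `M`: a pair `(L, R)` of linear maps with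
`L(fg) = L(f)g`, `R(fg) = fR(g)` and `fL(g) = R(f)g`. -/
structure Multiplier : Type (max u x) where
  L : M →ₗ[k] M
  R : M →ₗ[k] M
  L_mul : ∀ f g : M, L (f * g) = L f * g
  R_mul : ∀ f g : M, R (f * g) = f * R g
  cross : ∀ f g : M, f * L g = R f * g

namespace Multiplier

variable {k M}

@[ext] lemma ext {m n : Multiplier k M} (hL : m.L = n.L) (hR : m.R = n.R) : m = n := by
  cases m; cases n; simp_all

instance : Zero (Multiplier k M) :=
  ⟨⟨0, 0, by simp, by simp, by simp⟩⟩

instance : Add (Multiplier k M) :=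
  ⟨fun m n =>
    ⟨m.L + n.L, m.R + n.R,
      by intro f g; simp [m.L_mul, n.L_mul, add_mul],
      by intro f g; simp [m.R_mul, n.R_mul, mul_add],
      by intro f g; simp [m.cross, n.cross, mul_add, add_mul]⟩⟩

instance : Neg (Multiplier k M) :=
  ⟨fun m =>
    ⟨-m.L, -m.R,
      by intro f g; simp [m.L_mul, neg_mul],
      by intro f g; simp [m.R_mul, mul_neg],
      by intro f g; simp [m.cross, mul_neg, neg_mul]⟩⟩

instance : SMul k (Multiplier k M) :=
  ⟨fun c m =>
    ⟨c • m.L, c • m.R,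
      by intro f g; simp [m.L_mul, smul_mul_assoc],
      by intro f g; simp [m.R_mul, mul_smul_comm],
      by intro f g; simp [m.cross, mul_smul_comm, smul_mul_assoc]⟩⟩

instance : Mul (Multiplier k M) :=
  ⟨fun m n =>
    ⟨m.L ∘ₗ n.L, n.R ∘ₗ m.R,
      by intro f g; simp [n.L_mul, m.L_mul],
      by intro f g; simp [m.R_mul, n.R_mul],
      by intro f g; simp [m.cross, n.cross]⟩⟩

@[simp] lemma zero_L : (0 : Multiplier k M).L = 0 := rfl
@[simp] lemma zero_R : (0 : Multiplier k M).R = 0 := rfl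
@[simp] lemma add_L (m n : Multiplier k M) : (m + n).L = m.L + n.L := rfl
@[simp] lemma add_R (m n : Multiplier k M) : (m + n).R = m.R + n.R := rfl
@[simp] lemma neg_L (m : Multiplier k M) : (-m).L = -m.L := rfl
@[simp] lemma neg_R (m : Multiplier k M) : (-m).R = -m.R := rfl
@[simp] lemma smul_L (c : k) (m : Multiplier k M) : (c • m).L = c • m.L := rfl
@[simp] lemma smul_R (c : k) (m : Multiplier k M) : (c • m).R = c • m.R := rfl
@[simp] lemma mul_L (m n : Multiplier k M) : (m * n).L = m.L ∘ₗ n.L := rfl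
@[simp] lemma mul_R (m n : Multiplier k M) : (m * n).R = n.R ∘ₗ m.R := rfl

instance : AddCommGroup (Multiplier k M) where
  add_assoc a b c := by ext <;> simp [add_assoc]
  zero_add a := by ext <;> simp
  add_zero a := by ext <;> simp
  add_comm a b := by ext <;> simp [add_comm]
  neg_add_cancel a := by ext <;> simp
  nsmul := nsmulRec
  zsmul := zsmulRec

instance : Module k (Multiplier k M) where
  one_smul m := by ext <;> simp
  mul_smul c d m := by ext <;> simp [mul_smul]
  smul_zero c := by ext <;> simp
  smul_add c m n := by ext <;> simp
  add_smul c d m := by ext <;> simp [add_smul]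
  zero_smul m := by ext <;> simp

end Multiplier

end MultiplierPrelim

section AdPrelim

variable (k : Type u) [CommRing k] (G : Type v) [Group G] (A : Type w)
  [NonUnitalRing A] [Module k A] [SMulCommClass k A A] [IsScalarTower k A A]

/-- The left-translation representation `λ_s f (r) = f (s⁻¹ r)` of `G` on `F(G,A)`. -/
def lamRep (s : G) : (G → A) →ₗ[k] (G → A) where
  toFun f := fun r => f (s⁻¹ * r)
  map_add' f g := rfl
  map_smul' c f := rfl

@[simp] lemma lamRep_apply (s : G) (f : G → A) (r : G) : lamRep k G A s f r = f (s⁻¹ * r) := rfl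

/-- The global action `Ad` of `G` on the multiplier algebra `M(F(G,A))`. -/
def AdAct (s : G) (m : Multiplier k (G → A)) : Multiplier k (G → A) where
  L := lamRep k G A s ∘ₗ m.L ∘ₗ lamRep k G A s⁻¹
  R := lamRep k G A s ∘ₗ m.R ∘ₗ lamRep k G A s⁻¹
  L_mul f g := by
    have h : lamRep k G A s⁻¹ (f * g) = lamRep k G A s⁻¹ f * lamRep k G A s⁻¹ g := rfl
    funext r
    simp only [LinearMap.comp_apply, h, m.L_mul, lamRep_apply, Pi.mul_apply]
    simp
  R_mul f g := by
    have h : lamRep k G A s⁻¹ (f * g) = lamRep k G A s⁻¹ f * lamRep k G A s⁻¹ g := rfl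
    funext r
    simp only [LinearMap.comp_apply, h, m.R_mul, lamRep_apply, Pi.mul_apply]
    simp
  cross f g := by
    have h := m.cross (lamRep k G A s⁻¹ f) (lamRep k G A s⁻¹ g)
    funext r
    have h' := congrFun h (s⁻¹ * r)
    simp only [Pi.mul_apply, lamRep_apply, LinearMap.comp_apply] at h' ⊢
    simpa using h'

@[simp] lemma AdAct_L (s : G) (m : Multiplier k (G → A)) :
    (AdAct k G A s m).L = lamRep k G A s ∘ₗ m.L ∘ₗ lamRep k G A s⁻¹ := rfl
@[simp] lemma AdAct_R (s : G) (m : Multiplier k (G → A)) :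
    (AdAct k G A s m).R = lamRep k G A s ∘ₗ m.R ∘ₗ lamRep k G A s⁻¹ := rfl

end AdPrelim

section EnvFamilyMultiplier

variable {k : Type u} [CommRing k] {G : Type v} [Group G] {A : Type w}
  [NonUnitalRing A] [Module k A] [SMulCommClass k A A] [IsScalarTower k A A]
  {α : AlgPartialAction k G A} {F : G → A → A → A}

lemma IsEnvFamily.mem_inv_inv (hF : IsEnvFamily α F) (t : G) (a b : A) :
    F t a b ∈ α.ideal t⁻¹⁻¹ := by
  simpa using hF.mem t a b

/-- The multiplier of `F(G,A)` attached to an element `a ∈ A` by an enveloping family. -/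
def IsEnvFamily.multiplier (hF : IsEnvFamily α F) (a : A) : Multiplier k (G → A) where
  L :=
    { toFun := fun f r => F r⁻¹ a (f r)
      map_add' := fun _ _ => funext fun _ => hF.add_right _ _ _ _
      map_smul' := fun _ _ => funext fun _ => hF.smul_right _ _ _ _ }
  R :=
    { toFun := fun f r => α.act r⁻¹ (F r (f r) a)
      map_add' := fun f g => funext fun r => by
        simp only [Pi.add_apply, hF.add_left]
        exact α.act_add _ _ (hF.mem_inv_inv _ _ _) _ (hF.mem_inv_inv _ _ _)
      map_smul' := fun c f => funext fun r => by
        simp only [Pi.smul_apply, hF.smul_left, RingHom.id_apply]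
        exact α.act_smul _ _ _ (hF.mem_inv_inv _ _ _) }
  L_mul _ _ := funext fun _ => hF.cond2a _ _ _ _
  R_mul f g := funext fun r => by
    simpa using hF.cond2b r⁻¹ (f r) (g r) a
  cross f g := funext fun r => by
    simpa using hF.cond2c r⁻¹ (f r) a (g r)

lemma AlgPartialAction.act_zero (α : AlgPartialAction k G A) (t : G) : α.act t 0 = 0 := by
  simpa using α.act_smul t 0 0 (Submodule.zero_mem _)

lemma IsEnvFamily.eq_zero_of_act_eq_zero (hF : IsEnvFamily α F) {t : G} {a b : A}
    (h : α.act t⁻¹ (F t a b) = 0) : F t a b = 0 :=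
  α.act_injOn t⁻¹ (hF.mem_inv_inv t a b) (Submodule.zero_mem _) (h.trans (α.act_zero _).symm)

variable (k G A) in
lemma AdAct_one (m : Multiplier k (G → A)) : AdAct k G A 1 m = m := by
  have h : lamRep k G A 1 = LinearMap.id := by
    ext f r
    simp
  ext1 <;> simp [h]

end EnvFamilyMultiplier

/-- Given an enveloping family of functions `(F_t)` for `α`, the formulas
`[μ(a)f](r) = F_{r⁻¹}(a, f(r))` and `[fμ(a)](r) = α_{r⁻¹}(F_r(f(r), a))` define a multiplier
`μ(a) ∈ M(F(G,A))` for each `a ∈ A`; the resulting map `μ` is an injective algebra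
homomorphism, and `Ad_t(μ(a))·Ad_s(μ(b)) = Ad_s(μ(F_{s⁻¹t}(a,b)))` for all `s, t, a, b`. -/
theorem envFamily_defines_multiplier_embedding
    {k : Type u} [CommRing k] {G : Type v} [Group G] {A : Type w}
    [NonUnitalRing A] [Module k A] [SMulCommClass k A A] [IsScalarTower k A A]
    (α : AlgPartialAction k G A) (F : G → A → A → A) (hF : IsEnvFamily α F) :
    -- each pair of formulas is realized by an actual multiplier of F(G,A)
    (∃ μ : A → Multiplier k (G → A), ∀ (a : A) (f : G → A) (r : G),
      (μ a).L f r = F r⁻¹ a (f r) ∧ (μ a).R f r = α.act r⁻¹ (F r (f r) a)) ∧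
    -- and any such map μ is an injective algebra homomorphism satisfying the Ad-product rule
    (∀ μ : A → Multiplier k (G → A),
      (∀ (a : A) (f : G → A) (r : G),
        (μ a).L f r = F r⁻¹ a (f r) ∧ (μ a).R f r = α.act r⁻¹ (F r (f r) a)) →
      Function.Injective μ ∧
      (∀ a b : A, μ (a + b) = μ a + μ b) ∧
      (∀ (c : k) (a : A), μ (c • a) = c • μ a) ∧
      (∀ a b : A, μ (a * b) = μ a * μ b) ∧
      (∀ (s t : G) (a b : A),
        AdAct k G A t (μ a) * AdAct k G A s (μ b) = AdAct k G A s (μ (F (s⁻¹ * t) a b)))) := by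
  refine ⟨⟨hF.multiplier, fun a f r => ⟨rfl, rfl⟩⟩, fun μ hμ => ?_⟩
  have hL a f r : (μ a).L f r = F r⁻¹ a (f r) := (hμ a f r).1
  have hR a f r : (μ a).R f r = α.act r⁻¹ (F r (f r) a) := (hμ a f r).2
  have hadd a b : μ (a + b) = μ a + μ b := by
    apply Multiplier.ext <;> refine LinearMap.ext fun f => funext fun r => ?_
    · simp [hL, hF.add_left]
    · simp only [hR, hF.add_right, Multiplier.add_R, LinearMap.add_apply, Pi.add_apply]
      exact α.act_add _ _ (hF.mem_inv_inv _ _ _) _ (hF.mem_inv_inv _ _ _)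
  have hAd (s t : G) (a b : A) :
      AdAct k G A t (μ a) * AdAct k G A s (μ b) = AdAct k G A s (μ (F (s⁻¹ * t) a b)) := by
    apply Multiplier.ext <;> refine LinearMap.ext fun f => funext fun r => ?_
    · simpa [hL, mul_assoc] using (hF.cond3a (s⁻¹ * t) (r⁻¹ * s) a b (f r)).symm
    · simpa [hR, mul_assoc] using
        congrArg (α.act (r⁻¹ * s)) (hF.cond3b (t⁻¹ * r) (s⁻¹ * r) (f r) a b)
  refine ⟨?_, hadd, fun c a => ?_, fun a b => ?_, hAd⟩
  · refine (injective_iff_map_eq_zero (AddMonoidHom.mk' μ hadd)).2 fun a ha => ?_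
    replace ha : μ a = 0 := ha
    refine (hF.cond4 a).2 fun t b => ⟨?_, hF.eq_zero_of_act_eq_zero ?_⟩
    · simpa [ha] using (hL a (fun _ => b) t⁻¹).symm
    · simpa [ha] using (hR a (fun _ => b) t).symm
  · apply Multiplier.ext <;> refine LinearMap.ext fun f => funext fun r => ?_
    · simp [hL, hF.smul_left]
    · simp only [hR, hF.smul_right, Multiplier.smul_R, LinearMap.smul_apply, Pi.smul_apply]
      exact α.act_smul _ _ _ (hF.mem_inv_inv _ _ _)
  · simpa [AdAct_one, hF.F_one] using (hAd 1 1 a b).symm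
end
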